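/- arXiv:1609.00303 — 3 statements merged into one kernel-verified Lean document; each statement's English description precedes it below -/
import Mathlib

section
/- Every torsion group acting by homeomorphisms on a dendrite has a fixed point. -/
open Set

/-- A dendrite: a nonempty compact connected metrizable space that is locally
connected and contains no simple closed curve. -/
def IsDendrite (X : Type*) [TopologicalSpace X] : Prop :=
  Nonempty X ∧ CompactSpace X ∧ ConnectedSpace X ∧ TopologicalSpace.MetrizableSpace X ∧
    LocallyConnectedSpace X ∧ ¬ ∃ S : Set X, Nonempty (S ≃ₜ Circle)

namespace TorsDend

theorem compl_comp_preconnected {X : Type*} [TopologicalSpace X] [T1Space X] [ConnectedSpace X]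
    [LocallyConnectedSpace X] (c x : X) :
    IsPreconnected (connectedComponentIn {c}ᶜ x)ᶜ := by
  have hc : ∀ z, c ∉ connectedComponentIn {c}ᶜ z := fun z h =>
    connectedComponentIn_subset _ _ h rfl
  refine isPreconnected_of_forall c fun z hz => ?_
  by_cases hzc : z = c
  · subst hzc
    exact ⟨{z}, by simpa using hc x, rfl, rfl, isPreconnected_singleton⟩
  have hzD : z ∈ connectedComponentIn {c}ᶜ z := mem_connectedComponentIn hzc
  have hop : IsOpen (connectedComponentIn {c}ᶜ z) := isOpen_compl_singleton.connectedComponentIn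
  have hcl : c ∈ closure (connectedComponentIn {c}ᶜ z) := by
    by_contra hn
    have hsub : closure (connectedComponentIn {c}ᶜ z) ⊆ connectedComponentIn {c}ᶜ z :=
      isPreconnected_connectedComponentIn.closure.subset_connectedComponentIn
        (subset_closure hzD) (fun w hw hwc => hn (hwc ▸ hw))
    have hclopen : IsClopen (connectedComponentIn {c}ᶜ z) :=
      ⟨isClosed_of_closure_subset hsub, hop⟩
    have := hclopen.eq_univ ⟨z, hzD⟩
    exact hc z (this ▸ mem_univ c)
  refine ⟨insert c (connectedComponentIn {c}ᶜ z), ?_, mem_insert _ _, mem_insert_of_mem _ hzD, ?_⟩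
  · rintro w (rfl | hw) hwx
    · exact hc x hwx
    · apply hz
      rw [connectedComponentIn_eq hwx, ← connectedComponentIn_eq hw]
      exact hzD
  · exact isPreconnected_connectedComponentIn.subset_closure (subset_insert _ _)
      (insert_subset hcl subset_closure)

theorem sep_smul {G X : Type*} [Group G] [TopologicalSpace X] [MulAction G X]
    [ContinuousConstSMul G X] (g : G) {c x y : X} (hx : x ≠ c)
    (h : y ∉ connectedComponentIn {c}ᶜ x) :
    g • y ∉ connectedComponentIn {g • c}ᶜ (g • x) := by
  have := (Homeomorph.smul g).image_connectedComponentIn (s := {c}ᶜ) (x := x) hx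
  rw [image_compl_eq (Homeomorph.smul g).bijective, image_singleton] at this
  simp only [Homeomorph.smul_apply] at this
  rw [← this]
  rintro ⟨w, hw, hwy⟩
  change g • w = g • y at hwy
  rw [MulAction.injective g hwy] at hw
  exact h hw

theorem torsion_inv {G X : Type*} [Group G] [MulAction G X] (htors : Monoid.IsTorsion G)
    (g : G) (S : Set X) (h : ∀ x ∈ S, g • x ∈ S) : ∀ x ∈ S, g⁻¹ • x ∈ S := by
  have hp : ∀ n : ℕ, ∀ x ∈ S, g ^ n • x ∈ S := by
    intro n
    induction n with
    | zero => simp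
    | succ n ih => intro x hx; rw [pow_succ, mul_smul]; exact ih _ (h x hx)
  obtain ⟨n, hn, hg⟩ := (isOfFinOrder_iff_pow_eq_one).1 (htors g)
  have : g⁻¹ = g ^ (n - 1) := by
    rw [inv_eq_iff_mul_eq_one, ← pow_succ', Nat.sub_add_cancel hn, hg]
  rw [this]
  exact hp _

/-- The group-theoretic part: if points are separated by points, torsion groups fix a point. -/
theorem fixed_of_sep {G X : Type*} [Group G] [TopologicalSpace X] [MulAction G X]
    [ContinuousConstSMul G X] [T2Space X] [CompactSpace X] [ConnectedSpace X]
    [LocallyConnectedSpace X] (htors : Monoid.IsTorsion G)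
    (hsep : ∀ x y : X, x ≠ y → ∃ c, c ≠ x ∧ c ≠ y ∧ y ∉ connectedComponentIn {c}ᶜ x) :
    ∃ x : X, ∀ g : G, g • x = x := by
  let S : Set (Set X) := {K | IsClosed K ∧ K.Nonempty ∧ (∀ g : G, ∀ x ∈ K, g • x ∈ K) ∧
    ∀ x ∈ K, ∀ y ∈ K, ∀ c, c ≠ x → c ≠ y → y ∉ connectedComponentIn {c}ᶜ x → c ∈ K}
  obtain ⟨K, hKu, hK⟩ := zorn_superset_nonempty S (by
    intro ch hchS hch hne
    refine ⟨⋂₀ ch, ⟨isClosed_sInter fun s hs => (hchS hs).1, ?_, ?_, ?_⟩,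
      fun s hs => sInter_subset_of_mem hs⟩
    · have : Nonempty ch := hne.to_subtype
      exact IsCompact.nonempty_sInter_of_directed_nonempty_isCompact_isClosed
        (fun a ha b hb => (hch.total ha hb).elim (fun h => ⟨a, ha, subset_rfl, h⟩)
          (fun h => ⟨b, hb, h, subset_rfl⟩)) (fun s hs => (hchS hs).2.1)
        (fun s hs => (hchS hs).1.isCompact) (fun s hs => (hchS hs).1)
    · intro g x hx s hs
      exact (hchS hs).2.2.1 g x (hx s hs)
    · intro x hx y hy c h1 h2 h3 s hs
      exact (hchS hs).2.2.2 x (hx s hs) y (hy s hs) c h1 h2 h3) univ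
    ⟨isClosed_univ, univ_nonempty, by simp, by simp⟩
  obtain ⟨hKcl, ⟨x, hx⟩, hKinv, hKconv⟩ := hK.prop
  by_cases hall : ∀ y ∈ K, y = x
  · exact ⟨x, fun g => hall _ (hKinv g x hx)⟩
  push Not at hall
  obtain ⟨y, hy, hyx⟩ := hall
  obtain ⟨c, hcx, hcy, hc⟩ := hsep x y hyx.symm
  have hcK : c ∈ K := hKconv x hx y hy c hcx hcy hc
  -- every component meeting `K` meets the orbit of `c`
  have key : ∀ z ∈ K, z ≠ c → ∃ g : G, g • c ∈ connectedComponentIn {c}ᶜ z := by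
    intro z hz hzc
    by_contra hno
    push Not at hno
    set C := connectedComponentIn {c}ᶜ z with hC
    have hop : IsOpen C := isOpen_compl_singleton.connectedComponentIn
    have hmem : {w | w ∈ K ∧ ∀ g : G, g • w ∉ C} ∈ S := by
      refine ⟨?_, ⟨c, hcK, hno⟩, ?_, ?_⟩
      · have : {w | w ∈ K ∧ ∀ g : G, g • w ∉ C} = K ∩ ⋂ g : G, (fun w => g • w) ⁻¹' Cᶜ := by
          ext w; simp
        rw [this]
        exact hKcl.inter (isClosed_iInter fun g =>
          hop.isClosed_compl.preimage (continuous_const_smul g))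
      · rintro g w ⟨hw, hw'⟩
        refine ⟨hKinv g w hw, fun g' => ?_⟩
        rw [smul_smul]; exact hw' _
      · rintro a ⟨ha, ha'⟩ b ⟨hb, hb'⟩ d hda hdb hd
        refine ⟨hKconv a ha b hb d hda hdb hd, fun g hg => ?_⟩
        apply sep_smul g hda.symm hd
        have hpre : IsPreconnected Cᶜ := compl_comp_preconnected c z
        refine hpre.subset_connectedComponentIn (ha' g) ?_ (hb' g)
        intro w hw hwd
        rw [mem_singleton_iff] at hwd
        subst hwd
        exact hw hg
    have hle := hK.le_of_le hmem (fun w hw => hw.1)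
    have := (hle hz).2 1
    rw [one_smul] at this
    exact this (mem_connectedComponentIn hzc)
  have flip : ∀ z, ∀ g : G, g • c ∈ connectedComponentIn {c}ᶜ z →
      ∀ w, w ∉ connectedComponentIn {c}ᶜ z → g • w ∈ connectedComponentIn {c}ᶜ z := by
    intro z g hg
    set C := connectedComponentIn {c}ᶜ z with hC
    have hcC : c ∉ C := fun h => connectedComponentIn_subset _ _ h rfl
    have hpre : IsPreconnected ((fun w => g⁻¹ • w) '' Cᶜ) :=
      (compl_comp_preconnected c z).image _ (continuous_const_smul g⁻¹).continuousOn
    by_cases hm : ∃ u ∈ C, g • u ∉ C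
    · obtain ⟨u, hu, hgu⟩ := hm
      have hsub : (fun w => g⁻¹ • w) '' Cᶜ ⊆ C := by
        have hCu : C = connectedComponentIn {c}ᶜ u := connectedComponentIn_eq hu
        refine HasSubset.Subset.trans ?_ hCu.superset
        refine hpre.subset_connectedComponentIn (x := u) ⟨g • u, hgu, by simp⟩ ?_
        rintro _ ⟨w, hw, rfl⟩ hwc
        apply hw
        have : w = g • c := by
          rw [← mem_singleton_iff.1 hwc]; simp
        rw [this]; exact hg
      intro w hw
      by_contra hgw
      exact hw (hsub ⟨g • w, hgw, by simp⟩)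
    · push Not at hm
      have := torsion_inv htors g C hm _ hg
      rw [inv_smul_smul] at this
      exact absurd this hcC
  obtain ⟨g, hg⟩ := key x hx hcx.symm
  obtain ⟨h, hh⟩ := key y hy hcy.symm
  have fg := flip x g hg
  have fh := flip y h hh
  have hdisj : ∀ w, w ∈ connectedComponentIn {c}ᶜ x → w ∉ connectedComponentIn {c}ᶜ y := by
    intro w hw1 hw2
    apply hc
    rw [connectedComponentIn_eq hw1, ← connectedComponentIn_eq hw2]
    exact mem_connectedComponentIn hcy.symm
  have hgh := torsion_inv htors (g * h) (connectedComponentIn {c}ᶜ x) (fun w hw => by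
    rw [mul_smul]
    exact fg _ (fun hw' => hdisj _ hw' (fh w (hdisj w hw)))) _ hg
  have h1 := fh _ (hdisj _ hgh)
  rw [mul_inv_rev, mul_smul, inv_smul_smul, smul_inv_smul] at h1
  exact absurd h1 (fun h => connectedComponentIn_subset _ _ h rfl)

end TorsDend

namespace TorsDend

open Filter Topology

/-- `a` and `b` lie in a common small connected open set. -/
def Rel {X : Type*} [MetricSpace X] (ε : ℝ) (a b : X) : Prop :=
  ∃ V : Set X, IsOpen V ∧ IsPreconnected V ∧ a ∈ V ∧ b ∈ V ∧ ∀ p ∈ V, ∀ q ∈ V, dist p q < ε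

section
variable {X : Type*} [MetricSpace X] [LocallyConnectedSpace X]

theorem exists_small (x : X) {ε : ℝ} (hε : 0 < ε) :
    ∃ V : Set X, IsOpen V ∧ IsPreconnected V ∧ x ∈ V ∧ ∀ p ∈ V, ∀ q ∈ V, dist p q < ε := by
  have hx : x ∈ Metric.ball x (ε / 2) := Metric.mem_ball_self (half_pos hε)
  refine ⟨connectedComponentIn (Metric.ball x (ε / 2)) x,
    Metric.isOpen_ball.connectedComponentIn,
    isPreconnected_connectedComponentIn, mem_connectedComponentIn hx, fun p hp q hq => ?_⟩
  have h1 := connectedComponentIn_subset _ _ hp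
  have h2 := connectedComponentIn_subset _ _ hq
  rw [Metric.mem_ball] at h1 h2
  have := dist_triangle_right p q x
  linarith

theorem rel_refl (x : X) {ε : ℝ} (hε : 0 < ε) : Rel ε x x := by
  obtain ⟨V, h1, h2, h3, h4⟩ := exists_small x hε
  exact ⟨V, h1, h2, h3, h3, h4⟩

/-- Chains inside a set. -/
def Chn (ε : ℝ) (V : Set X) (N : ℕ) (a b : X) : Prop :=
  ∃ u : ℕ → X, u 0 = a ∧ (∀ j, N ≤ j → u j = b) ∧ (∀ j, u j ∈ V) ∧ ∀ j, Rel ε (u j) (u (j + 1))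

theorem Chn.mono {ε : ℝ} {V : Set X} {N N' : ℕ} {a b : X} (h : Chn ε V N a b) (hN : N ≤ N') :
    Chn ε V N' a b := by
  obtain ⟨u, h1, h2, h3, h4⟩ := h
  exact ⟨u, h1, fun j hj => h2 j (hN.trans hj), h3, h4⟩

theorem exists_chn {ε : ℝ} (hε : 0 < ε) {V : Set X} (hV : IsPreconnected V) {a b : X}
    (ha : a ∈ V) (hb : b ∈ V) : ∃ N, Chn ε V N a b := by
  have key : Relation.ReflTransGen (fun p q => p ∈ V ∧ q ∈ V ∧ Rel ε p q) a b := by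
    refine hV.induction₂' _ (fun x hx => ?_) (fun x y z _ _ _ h h' => h.trans h') ha hb
    obtain ⟨W, h1, h2, h3, h4⟩ := exists_small x hε
    filter_upwards [self_mem_nhdsWithin, mem_nhdsWithin_of_mem_nhds (h1.mem_nhds h3)] with y hy hyW
    exact ⟨.single ⟨hx, hy, W, h1, h2, h3, hyW, h4⟩, .single ⟨hy, hx, W, h1, h2, hyW, h3, h4⟩⟩
  induction key using Relation.ReflTransGen.head_induction_on with
  | refl => exact ⟨0, fun _ => b, rfl, fun _ _ => rfl, fun _ => hb, fun _ => rel_refl b hε⟩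
  | @head p q h _ ih =>
    obtain ⟨N, u, h1, h2, h3, h4⟩ := ih h.2.1
    refine ⟨N + 1, fun j => Nat.casesOn j p u, rfl, ?_, ?_, ?_⟩
    · rintro (_ | j) hj
      · omega
      · exact h2 j (by omega)
    · rintro (_ | j)
      · exact ha
      · exact h3 j
    · rintro (_ | j)
      · change Rel ε p (u 0)
        rw [h1]; exact h.2.2
      · exact h4 j

def Good (x y : X) (ε : ℝ) (s : ℕ × (ℕ → X)) : Prop :=
  0 < s.1 ∧ s.2 0 = x ∧ (∀ k, s.1 ≤ k → s.2 k = y) ∧ ∀ k, Rel ε (s.2 k) (s.2 (k + 1))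

theorem refine_step {x y : X} {ε ε' : ℝ} (hε : 0 < ε) (hε' : 0 < ε') (s : ℕ × (ℕ → X))
    (hs : Good x y ε s) : ∃ s', Good x y ε' s' ∧ ∃ N : ℕ, 0 < N ∧ s'.1 = s.1 * N ∧
      ∀ k, dist (s.2 (k / N)) (s'.2 k) < ε := by
  obtain ⟨M, c⟩ := s
  obtain ⟨hM, h0, h1, h2⟩ := hs
  simp only at hM h0 h1 h2
  have hch : ∀ k, ∃ V : Set X, (c k ∈ V ∧ ∀ p ∈ V, ∀ q ∈ V, dist p q < ε) ∧
      ∃ N, Chn ε' V N (c k) (c (k + 1)) := by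
    intro k
    obtain ⟨V, _, hVc, ha, hb, hd⟩ := h2 k
    exact ⟨V, ⟨ha, hd⟩, exists_chn hε' hVc ha hb⟩
  choose V hV n hn using hch
  let N := (Finset.range M).sup n + 1
  have hN : 0 < N := Nat.succ_pos _
  have hu : ∀ k, ∃ u : ℕ → X, u 0 = c k ∧ u N = c (k + 1) ∧ (∀ j, dist (c k) (u j) < ε) ∧
      (∀ j, Rel ε' (u j) (u (j + 1))) ∧ (M ≤ k → ∀ j, u j = y) := by
    intro k
    by_cases hk : k < M
    · have : n k ≤ N := (Finset.le_sup (f := n) (Finset.mem_range.2 hk)).trans (Nat.le_succ _)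
      obtain ⟨u, u1, u2, u3, u4⟩ := (hn k).mono this
      exact ⟨u, u1, u2 N le_rfl, fun j => (hV k).2 _ (hV k).1 _ (u3 j), u4, fun h => by omega⟩
    · push Not at hk
      refine ⟨fun _ => y, (h1 k hk).symm, (h1 _ (by omega)).symm, fun j => ?_, fun j =>
        rel_refl _ hε', fun _ _ => rfl⟩
      rw [h1 k hk, dist_self]; exact hε
  choose u u0 uN ud ur uy using hu
  refine ⟨(M * N, fun k => u (k / N) (k % N)), ⟨Nat.mul_pos hM hN, ?_, ?_, ?_⟩, N, hN, rfl, ?_⟩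
  · simp [u0, h0]
  · intro k hk
    exact uy _ ((Nat.le_div_iff_mul_le hN).2 hk) _
  · intro k
    simp only
    have hdm := Nat.div_add_mod k N
    have hlt := Nat.mod_lt k hN
    by_cases hk : k % N + 1 < N
    · have e1 : (k + 1) / N = k / N := by
        rw [Nat.div_eq_iff hN]
        have : k / N * N = N * (k / N) := mul_comm _ _
        constructor <;> omega
      have e2 : (k + 1) % N = k % N + 1 := by
        have := Nat.div_add_mod (k + 1) N
        rw [e1] at this
        omega
      rw [e1, e2]; exact ur _ _
    · have hkN : k % N + 1 = N := by omega
      have hk1 : k + 1 = N * (k / N + 1) := by rw [mul_add]; omega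
      have e1 : (k + 1) / N = k / N + 1 := by rw [hk1, Nat.mul_div_cancel_left _ hN]
      have e2 : (k + 1) % N = 0 := by rw [hk1, Nat.mul_mod_right]
      rw [e1, e2, u0, ← uN]
      have := ur (k / N) (k % N)
      rwa [hkN] at this
  · intro k
    exact ud _ _

theorem exists_path [CompleteSpace X] {x y : X} {C : ℝ} (hC : 0 < C) (h : Rel (C / 2) x y) :
    ∃ γ : Path x y, ∀ t, dist (γ t) x ≤ 2 * C := by
  let ε : ℕ → ℝ := fun n => C / 2 / 2 ^ n
  have hε : ∀ n, 0 < ε n := fun n => by positivity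
  choose! nx hnx using fun (n : ℕ) (s : ℕ × (ℕ → X)) (hs : Good x y (ε n) s) =>
    refine_step (hε n) (hε (n + 1)) s hs
  let sq : ℕ → ℕ × (ℕ → X) := fun n =>
    Nat.rec (1, fun k => if k = 0 then x else y) (fun n s => nx n s) n
  have hsq : ∀ n, Good x y (ε n) (sq n) := by
    intro n
    induction n with
    | zero =>
      refine ⟨Nat.one_pos, rfl, fun k hk => ?_, fun k => ?_⟩
      · have : k ≠ 0 := by
          rintro rfl
          exact absurd hk (by simp [sq])
        simp [sq, this]
      · by_cases hk : k = 0
        · subst hk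
          simpa [sq, ε] using h
        · simpa [sq, hk] using rel_refl y (hε 0)
    | succ n ih => exact (hnx n (sq n) ih).1
  let f : ℕ → ℝ → X := fun n t => (sq n).2 ⌊t * (sq n).1⌋₊
  have hf : ∀ t n, dist (f n t) (f (n + 1) t) ≤ C / 2 / 2 ^ n := by
    intro t n
    obtain ⟨-, N, hN, hM, hd⟩ := hnx n (sq n) (hsq n)
    have hM' : (sq (n + 1)).1 = (sq n).1 * N := hM
    have := (hd ⌊t * (sq (n + 1)).1⌋₊).le
    rw [← Nat.floor_div_natCast] at this
    have e : t * ((sq (n + 1)).1 : ℝ) / N = t * (sq n).1 := by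
      rw [hM']; push_cast
      have : (N : ℝ) ≠ 0 := by positivity
      field_simp
    rw [e] at this
    exact this
  have hcau : ∀ t, CauchySeq fun n => f n t := fun t => cauchySeq_of_le_geometric_two (hf t)
  choose F hF using fun t => cauchySeq_tendsto_of_complete (hcau t)
  have hFd : ∀ t n, dist (f n t) (F t) ≤ C / 2 ^ n := fun t n =>
    dist_le_of_le_geometric_two_of_tendsto (hf t) (hF t) n
  have h0 : F 0 = x := by
    refine tendsto_nhds_unique (hF 0) ?_
    have : (fun n => f n 0) = fun _ => x := by
      ext n
      simp only [f, zero_mul, Nat.floor_zero]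
      exact (hsq n).2.1
    rw [this]; exact tendsto_const_nhds
  have h1 : F 1 = y := by
    refine tendsto_nhds_unique (hF 1) ?_
    have : (fun n => f n 1) = fun _ => y := by
      ext n
      simp only [f, one_mul, Nat.floor_natCast]
      exact (hsq n).2.2.1 _ le_rfl
    rw [this]; exact tendsto_const_nhds
  have hstep : ∀ n (s t : ℝ), 0 ≤ s → s ≤ t → t - s < 1 / (sq n).1 →
      dist (f n s) (f n t) ≤ C / 2 ^ n := by
    intro n s t hs hst hlt
    have hM : (0 : ℝ) < (sq n).1 := by exact_mod_cast (hsq n).1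
    have hlt' : t * (sq n).1 < s * (sq n).1 + 1 := by
      rw [lt_div_iff₀ hM] at hlt
      linarith
    have ha : ⌊s * (sq n).1⌋₊ ≤ ⌊t * (sq n).1⌋₊ := Nat.floor_mono (by gcongr)
    have hb : ⌊t * (sq n).1⌋₊ ≤ ⌊s * (sq n).1⌋₊ + 1 := by
      rw [← Nat.floor_add_one (by positivity)]
      exact Nat.floor_mono hlt'.le
    rcases (by omega : ⌊t * (sq n).1⌋₊ = ⌊s * (sq n).1⌋₊ ∨
      ⌊t * (sq n).1⌋₊ = ⌊s * (sq n).1⌋₊ + 1) with e | e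
    · simp only [f, e, dist_self]; positivity
    · simp only [f, e]
      obtain ⟨V, -, -, hp, hq, hd⟩ := (hsq n).2.2.2 ⌊s * (sq n).1⌋₊
      have := hd _ hp _ hq
      have h2 : ε n ≤ C / 2 ^ n := by
        simp only [ε]; gcongr; linarith
      linarith
  have hcont : ContinuousOn F (Icc 0 1) := by
    rw [Metric.continuousOn_iff]
    intro t ht η hη
    obtain ⟨n, hn⟩ := exists_pow_lt_of_lt_one (show 0 < η / (3 * C) by positivity)
      (show (1 / 2 : ℝ) < 1 by norm_num)
    have hn' : 3 * (C / 2 ^ n) < η := by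
      rw [lt_div_iff₀ (by positivity)] at hn
      calc 3 * (C / 2 ^ n) = (1 / 2 : ℝ) ^ n * (3 * C) := by
            rw [one_div, inv_pow]; ring
        _ < η := hn
    have hM : (0 : ℝ) < (sq n).1 := by exact_mod_cast (hsq n).1
    refine ⟨1 / (sq n).1, by positivity, fun s hs hst => ?_⟩
    have h3 : dist (f n s) (f n t) ≤ C / 2 ^ n := by
      rw [Real.dist_eq, abs_lt] at hst
      rcases le_total s t with hle | hle
      · exact hstep n s t hs.1 hle (by linarith)
      · rw [dist_comm]; exact hstep n t s ht.1 hle (by linarith)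
    have h4 := hFd s n
    have h5 := hFd t n
    have := dist_triangle4 (F s) (f n s) (f n t) (F t)
    rw [dist_comm (F s) (f n s)] at this
    linarith
  refine ⟨⟨⟨fun t => F t, ?_⟩, by simpa using h0, by simpa using h1⟩, fun t => ?_⟩
  · exact continuousOn_iff_continuous_domRestrict.1 hcont
  · change dist (F t) x ≤ 2 * C
    have h4 := hFd t 0
    have h5 : dist (f 0 t) x ≤ C := by
      obtain ⟨V, -, -, hp, hq, hd⟩ := h
      change dist (if ⌊(t : ℝ) * (1 : ℕ)⌋₊ = 0 then x else y) x ≤ C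
      split_ifs
      · rw [dist_self]; exact hC.le
      · have := hd _ hq _ hp
        linarith
    have := dist_triangle_left (F t) x (f 0 t)
    simp only [pow_zero, div_one] at h4
    linarith

theorem locPath [CompleteSpace X] : LocallyPathConnectedSpace X := by
  rw [locallyPathConnectedSpace_iff_pathComponentIn_mem_nhds]
  intro x u hu hxu
  obtain ⟨r, hr, hru⟩ := Metric.isOpen_iff.1 hu x hxu
  obtain ⟨V, h1, h2, h3, h4⟩ := exists_small x (show 0 < r / 4 / 2 by positivity)
  refine mem_of_superset (h1.mem_nhds h3) fun y hy => ?_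
  obtain ⟨γ, hγ⟩ := exists_path (show 0 < r / 4 by positivity) ⟨V, h1, h2, h3, hy, h4⟩
  refine ⟨γ, fun t => hru ?_⟩
  have := hγ t
  rw [Metric.mem_ball]
  linarith

end

end TorsDend

namespace TorsDend

open Filter Topology

/-- Two arcs with the same endpoints, one not contained in the other, yield a circle. -/
theorem circle_of_arcs {X : Type*} [TopologicalSpace X] [T2Space X] (A B : ℝ → X)
    (hA : Continuous A) (hB : Continuous B) (iA : InjOn A (Icc 0 1)) (iB : InjOn B (Icc 0 1))
    (h0 : A 0 = B 0) (h1 : A 1 = B 1) (t0 : ℝ) (ht0 : t0 ∈ Icc (0 : ℝ) 1)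
    (ht : A t0 ∉ B '' Icc 0 1) : ∃ S : Set X, Nonempty (S ≃ₜ Circle) := by
  have hZ : IsClosed (A ⁻¹' (B '' Icc 0 1)) := (isCompact_Icc.image hB).isClosed.preimage hA
  obtain ⟨s0, ⟨hs0Z, hs0⟩, hs0max⟩ := (isCompact_Icc.inter_left hZ).exists_isGreatest
    (s := A ⁻¹' (B '' Icc 0 1) ∩ Icc 0 t0)
    ⟨0, ⟨0, by simp, h0.symm⟩, le_rfl, ht0.1⟩
  obtain ⟨s1, ⟨hs1Z, hs1⟩, hs1min⟩ := (isCompact_Icc.inter_left hZ).exists_isLeast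
    (s := A ⁻¹' (B '' Icc 0 1) ∩ Icc t0 1)
    ⟨1, ⟨1, by simp, h1.symm⟩, ht0.2, le_rfl⟩
  have hs0t : s0 < t0 := lt_of_le_of_ne hs0.2 (by rintro rfl; exact ht hs0Z)
  have hs1t : t0 < s1 := lt_of_le_of_ne hs1.1 (by rintro rfl; exact ht hs1Z)
  obtain ⟨p, hp, hpA⟩ := hs0Z
  obtain ⟨q, hq, hqA⟩ := hs1Z
  have h01 : s0 < s1 := hs0t.trans hs1t
  have hs0' : s0 ∈ Icc (0 : ℝ) 1 := ⟨hs0.1, hs0.2.trans ht0.2⟩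
  have hs1' : s1 ∈ Icc (0 : ℝ) 1 := ⟨ht0.1.trans hs1.1, hs1.2⟩
  have hpq : p ≠ q := by
    rintro rfl
    exact h01.ne (iA hs0' hs1' (hpA.symm.trans hqA))
  let a : ℝ → ℝ := fun t => s0 + t * (s1 - s0)
  let b : ℝ → ℝ := fun t => q + (t - 1) * (p - q)
  let f : ℝ → X := fun t => if t ≤ 1 then A (a t) else B (b t)
  have hf : Continuous f := by
    refine Continuous.if_le (hA.comp (by fun_prop)) (hB.comp (by fun_prop)) continuous_id
      continuous_const ?_
    rintro t rfl
    simp [a, b, hqA]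
  have ha : ∀ t, 0 ≤ t → t ≤ 1 → a t ∈ Icc s0 s1 := fun t h h' => by
    constructor <;> simp only [a] <;> nlinarith
  have ha' : ∀ t, 0 ≤ t → t ≤ 1 → a t ∈ Icc (0 : ℝ) 1 := fun t h h' =>
    ⟨hs0'.1.trans (ha t h h').1, (ha t h h').2.trans hs1'.2⟩
  have hb : ∀ t, 1 ≤ t → t ≤ 2 → b t ∈ Icc (0 : ℝ) 1 := fun t h h' => by
    have e : b t = (2 - t) * q + (t - 1) * p := by simp only [b]; ring
    rw [e]
    constructor
    · have := mul_nonneg (sub_nonneg.2 h') hq.1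
      have := mul_nonneg (sub_nonneg.2 h) hp.1
      linarith
    · have := mul_le_mul_of_nonneg_left hq.2 (sub_nonneg.2 h')
      have := mul_le_mul_of_nonneg_left hp.2 (sub_nonneg.2 h)
      linarith
  have hmix : ∀ t t', 0 ≤ t → t ≤ 1 → 1 < t' → t' < 2 → A (a t) ≠ B (b t') := by
    intro t t' h h' k k' he
    have hbt := hb t' k.le k'.le
    have hat := ha t h h'
    have hat' := ha' t h h'
    have hZt : a t ∈ A ⁻¹' (B '' Icc 0 1) := ⟨b t', hbt, he.symm⟩
    have : a t = s0 ∨ a t = s1 := by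
      rcases le_total (a t) t0 with hl | hl
      · exact Or.inl (le_antisymm (hs0max ⟨hZt, hat'.1, hl⟩) hat.1)
      · exact Or.inr (le_antisymm hat.2 (hs1min ⟨hZt, hl, hat'.2⟩))
    rcases this with e | e
    · rw [e, ← hpA] at he
      have h3 := iB hp hbt he
      have : (2 - t') * (p - q) = 0 := by simp only [b] at h3; linarith
      rcases mul_eq_zero.1 this with h4 | h4
      · linarith
      · exact hpq (sub_eq_zero.1 h4)
    · rw [e, ← hqA] at he
      have h3 := iB hq hbt he
      have : (t' - 1) * (p - q) = 0 := by simp only [b] at h3; linarith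
      rcases mul_eq_zero.1 this with h4 | h4
      · linarith
      · exact hpq (sub_eq_zero.1 h4)
  have hinj : InjOn f (Ico 0 2) := by
    intro t htt t' htt' he
    simp only [f] at he
    split_ifs at he with c1 c2 c2
    · have := iA (ha' t htt.1 c1) (ha' t' htt'.1 c2) he
      simp only [a] at this
      have h3 : (t - t') * (s1 - s0) = 0 := by linarith
      rcases mul_eq_zero.1 h3 with h4 | h4 <;> linarith
    · push Not at c2
      exact absurd he (hmix t t' htt.1 c1 c2 htt'.2)
    · push Not at c1
      exact absurd he.symm (hmix t' t htt'.1 c2 c1 htt.2)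
    · push Not at c1 c2
      have := iB (hb t c1.le htt.2.le) (hb t' c2.le htt'.2.le) he
      simp only [b] at this
      have h3 : (t - t') * (p - q) = 0 := by linarith
      rcases mul_eq_zero.1 h3 with h4 | h4
      · linarith
      · exact absurd (sub_eq_zero.1 h4) hpq
  have : Fact ((0 : ℝ) < 2) := ⟨two_pos⟩
  have hf02 : f 0 = f 2 := by
    have e : b 2 = p := by simp only [b]; ring
    have e' : f 2 = B (b 2) := if_neg (by norm_num)
    rw [e', e, hpA]
    simp [f, a]
  let F : AddCircle (2 : ℝ) → X := AddCircle.liftIco 2 0 f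
  have hFc : Continuous F := AddCircle.liftIco_zero_continuous hf02 hf.continuousOn
  have hFi : Function.Injective F := by
    intro z w hzw
    obtain ⟨z, hz, rfl⟩ := AddCircle.eq_coe_Ico z
    obtain ⟨w, hw, rfl⟩ := AddCircle.eq_coe_Ico w
    simp only [F] at hzw
    rw [AddCircle.liftIco_zero_coe_apply hz, AddCircle.liftIco_zero_coe_apply hw] at hzw
    rw [hinj hz hw hzw]
  have hemb := (hFc.isClosedEmbedding hFi).isEmbedding
  exact ⟨range F, ⟨hemb.toHomeomorph.symm.trans (AddCircle.homeomorphCircle two_ne_zero)⟩⟩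

/-- A path whose fibres are intervals can be reparametrised to an arc. -/
theorem arc_of_monotone {X : Type*} [MetricSpace X] [TopologicalSpace.SeparableSpace X]
    (σ : ℝ → X) (hσ : Continuous σ) (hne : σ 0 ≠ σ 1)
    (hmono : ∀ s ∈ Icc (0 : ℝ) 1, ∀ t ∈ Icc (0 : ℝ) 1, σ s = σ t → ∀ u, s ≤ u → u ≤ t → σ u = σ s) :
    ∃ e : ℝ → X, Continuous e ∧ InjOn e (Icc 0 1) ∧ e 0 = σ 0 ∧ e 1 = σ 1 ∧
      ∀ t, ∃ s ∈ Icc (0 : ℝ) 1, e t = σ s := by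
  have : Nonempty X := ⟨σ 0⟩
  let d := TopologicalSpace.denseSeq X
  let φ : ℕ → X → ℝ := fun n z => min 1 (dist z (d n))
  have hφ : ∀ n, Continuous (φ n) := fun n => by fun_prop
  have hφ0 : ∀ n z, 0 ≤ φ n z := fun n z => le_min zero_le_one dist_nonneg
  have hφ1 : ∀ n z, φ n z ≤ 1 := fun n z => min_le_left _ _
  let m : ℕ → ℝ → ℝ := fun n t => sInf ((fun u => φ n (σ (t * u))) '' Icc 0 1)
  have hm : ∀ n, Continuous (m n) := fun n =>
    isCompact_Icc.continuous_sInf (f := fun t u => φ n (σ (t * u)))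
      ((hφ n).comp (hσ.comp continuous_mul))
  have hbdd : ∀ n t, BddBelow ((fun u => φ n (σ (t * u))) '' Icc (0 : ℝ) 1) := fun n t =>
    ⟨0, by rintro _ ⟨u, _, rfl⟩; exact hφ0 _ _⟩
  have hmle : ∀ n t s, 0 ≤ s → s ≤ t → m n t ≤ φ n (σ s) := by
    intro n t s hs hst
    rcases hs.eq_or_lt with rfl | hs'
    · exact csInf_le (hbdd n t) ⟨0, by simp, by simp⟩
    · have htp : 0 < t := hs'.trans_le hst
      refine csInf_le (hbdd n t) ⟨s / t, ⟨by positivity, (div_le_one htp).2 hst⟩, ?_⟩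
      simp only
      rw [mul_div_cancel₀ _ htp.ne']
  have hlem : ∀ n t (r : ℝ), 0 ≤ t → (∀ s, 0 ≤ s → s ≤ t → r ≤ φ n (σ s)) → r ≤ m n t := by
    intro n t r ht h
    refine le_csInf ⟨_, 0, by simp, rfl⟩ ?_
    rintro _ ⟨u, hu, rfl⟩
    exact h _ (mul_nonneg ht hu.1) (mul_le_of_le_one_right ht hu.2)
  have hanti : ∀ n s t, 0 ≤ s → s ≤ t → m n t ≤ m n s := fun n s t hs hst =>
    hlem n s _ hs fun u hu hus => hmle n t u hu (hus.trans hst)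
  have hm0 : ∀ n t, 0 ≤ m n t := fun n t => by
    refine le_csInf ⟨_, 0, by simp, rfl⟩ ?_
    rintro _ ⟨u, hu, rfl⟩
    exact hφ0 _ _
  have hm1 : ∀ n t, m n t ≤ 1 := fun n t =>
    (csInf_le (hbdd n t) ⟨0, by simp, rfl⟩).trans (hφ1 _ _)
  let h : ℝ → ℝ := fun t => ∑' n, (1 / 2 : ℝ) ^ n * (1 - m n t)
  have hterm : ∀ n t, ‖(1 / 2 : ℝ) ^ n * (1 - m n t)‖ ≤ (1 / 2 : ℝ) ^ n := by
    intro n t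
    have hp : (0 : ℝ) ≤ (1 / 2) ^ n := by positivity
    rw [Real.norm_of_nonneg (mul_nonneg hp (by linarith [hm1 n t]))]
    exact mul_le_of_le_one_right hp (by linarith [hm0 n t])
  have hsum : ∀ t, Summable fun n => (1 / 2 : ℝ) ^ n * (1 - m n t) := fun t =>
    Summable.of_norm_bounded summable_geometric_two (fun n => hterm n t)
  have hcont : Continuous h := continuous_tsum
    (fun n => continuous_const.mul (continuous_const.sub (hm n))) summable_geometric_two hterm
  have hle : ∀ n s t, 0 ≤ s → s ≤ t →
      (1 / 2 : ℝ) ^ n * (1 - m n s) ≤ (1 / 2 : ℝ) ^ n * (1 - m n t) := fun n s t hs hst => by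
    have := hanti n s t hs hst
    gcongr
  have hhmono : ∀ s t, 0 ≤ s → s ≤ t → h s ≤ h t := fun s t hs hst =>
    (hsum s).tsum_le_tsum (fun n => hle n s t hs hst) (hsum t)
  -- equal heights give equal points
  have heq1 : ∀ s t, 0 ≤ s → s ≤ t → t ≤ 1 → h s = h t → σ s = σ t := by
    intro s t hs hst ht1 hst'
    have hmeq : ∀ n, m n s = m n t := by
      intro n
      by_contra hn
      have hlt : m n t < m n s := lt_of_le_of_ne (hanti n s t hs hst) (Ne.symm hn)
      have hp : (0 : ℝ) < (1 / 2) ^ n := by positivity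
      have : h s < h t := (hsum s).tsum_lt_tsum (i := n) (fun k => hle k s t hs hst)
        (by nlinarith) (hsum t)
      exact this.ne hst'
    have hmem : σ t ∈ σ '' Icc 0 s := by
      by_contra hno
      have hcl : IsClosed (σ '' Icc 0 s) := (isCompact_Icc.image hσ).isClosed
      obtain ⟨ρ, hρ, hball⟩ := Metric.isOpen_iff.1 hcl.isOpen_compl _ hno
      have hr : 0 < min 1 ρ / 2 := by positivity
      obtain ⟨n, hn⟩ := (TopologicalSpace.denseRange_denseSeq X).exists_dist_lt (σ t) hr
      have h2 : m n t < min 1 ρ / 2 := (hmle n t t (hs.trans hst) le_rfl).trans_lt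
        ((min_le_right _ _).trans_lt hn)
      have h3 : min 1 ρ / 2 ≤ m n s := by
        refine hlem n s _ hs fun u hu hus => le_min ?_ ?_
        · linarith [min_le_left 1 ρ]
        · have : ρ ≤ dist (σ u) (σ t) := by
            by_contra hlt
            push Not at hlt
            exact hball (Metric.mem_ball.2 hlt) ⟨u, ⟨hu, hus⟩, rfl⟩
          have h5 := dist_triangle_right (σ u) (σ t) (d n)
          have h6 : dist (σ t) (d n) < min 1 ρ / 2 := hn
          linarith [min_le_right 1 ρ]
      rw [hmeq n] at h3
      linarith
    obtain ⟨u, hu, hut⟩ := hmem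
    have := hmono u ⟨hu.1, hu.2.trans (hst.trans ht1)⟩ t ⟨hs.trans hst, ht1⟩ hut s hu.2 hst
    rw [this, hut]
  have heq2 : ∀ s t, 0 ≤ s → s ≤ t → t ≤ 1 → σ s = σ t → h s = h t := by
    intro s t hs hst ht1 he
    have hmeq : ∀ n, m n s = m n t := by
      intro n
      refine le_antisymm ?_ (hanti n s t hs hst)
      refine hlem n t _ (hs.trans hst) fun u hu hut => ?_
      rcases le_total u s with hus | hus
      · exact hmle n s u hu hus
      · rw [hmono s ⟨hs, hst.trans ht1⟩ t ⟨hs.trans hst, ht1⟩ he u hus hut]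
        exact hmle n s s hs le_rfl
    simp only [h, hmeq]
  have heq : ∀ s ∈ Icc (0 : ℝ) 1, ∀ t ∈ Icc (0 : ℝ) 1, h s = h t ↔ σ s = σ t := by
    intro s hs t ht
    rcases le_total s t with hst | hst
    · exact ⟨heq1 s t hs.1 hst ht.2, heq2 s t hs.1 hst ht.2⟩
    · exact ⟨fun e => (heq1 t s ht.1 hst hs.2 e.symm).symm,
        fun e => (heq2 t s ht.1 hst hs.2 e.symm).symm⟩
  have h01 : h 0 < h 1 := lt_of_le_of_ne (hhmono 0 1 le_rfl zero_le_one)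
    (fun e => hne ((heq 0 (by simp) 1 (by simp)).1 e))
  let H : Icc (0 : ℝ) 1 → Icc (h 0) (h 1) := fun t =>
    ⟨h t, hhmono 0 t le_rfl t.2.1, hhmono t 1 t.2.1 t.2.2⟩
  have hHc : Continuous H := (hcont.comp continuous_subtype_val).subtype_mk _
  have hHs : Function.Surjective H := by
    rintro ⟨y, hy⟩
    obtain ⟨t, ht, hty⟩ := intermediate_value_Icc zero_le_one hcont.continuousOn hy
    exact ⟨⟨t, ht⟩, Subtype.ext hty⟩
  have hq : IsQuotientMap H := hHc.isClosedMap.isQuotientMap hHc hHs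
  obtain ⟨iv, hiv⟩ := hHs.hasRightInverse
  let E : Icc (h 0) (h 1) → X := fun y => σ (iv y)
  have hE : ∀ t : Icc (0 : ℝ) 1, E (H t) = σ t := by
    intro t
    have h1 : H (iv (H t)) = H t := hiv (H t)
    exact (heq _ (iv (H t)).2 _ t.2).1 (congrArg Subtype.val h1)
  have hEc : Continuous E := by
    rw [hq.continuous_iff]
    have : E ∘ H = fun t : Icc (0 : ℝ) 1 => σ (t : ℝ) := funext hE
    rw [this]; exact hσ.comp continuous_subtype_val
  have hEi : Function.Injective E := by
    intro y z hyz
    obtain ⟨s, rfl⟩ := hHs y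
    obtain ⟨t, rfl⟩ := hHs z
    rw [hE, hE] at hyz
    exact Subtype.ext ((heq _ s.2 _ t.2).2 hyz)
  have hmem : ∀ t ∈ Icc (0 : ℝ) 1, h 0 + t * (h 1 - h 0) ∈ Icc (h 0) (h 1) := by
    intro t ht
    constructor <;> nlinarith [ht.1, ht.2]
  refine ⟨fun t => IccExtend h01.le E (h 0 + t * (h 1 - h 0)), ?_, ?_, ?_, ?_, ?_⟩
  · exact (hEc.Icc_extend' (h := h01.le)).comp (by fun_prop)
  · intro s hs t ht hst
    simp only [IccExtend_of_mem h01.le E (hmem s hs), IccExtend_of_mem h01.le E (hmem t ht)] at hst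
    have := congrArg Subtype.val (hEi hst)
    simp only at this
    have h3 : (s - t) * (h 1 - h 0) = 0 := by linarith
    rcases mul_eq_zero.1 h3 with h4 | h4 <;> linarith
  · simp only [IccExtend_of_mem h01.le E (hmem 0 (by simp))]
    rw [← hE ⟨0, by simp⟩]
    congr 1
    exact Subtype.ext (by simp [H])
  · simp only [IccExtend_of_mem h01.le E (hmem 1 (by simp))]
    rw [← hE ⟨1, by simp⟩]
    congr 1
    exact Subtype.ext (by simp [H])
  · intro t
    exact ⟨_, (iv _).2, rfl⟩

end TorsDend

namespace TorsDend

open Filter Topology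

/-- Closed subsets of `[0,1]` whose gaps have endpoints identified by `γ`. -/
def GapSet {X : Type*} (γ : ℝ → X) (F : Set ℝ) : Prop :=
  IsClosed F ∧ F ⊆ Icc 0 1 ∧ (0 : ℝ) ∈ F ∧ (1 : ℝ) ∈ F ∧
    ∀ a ∈ F, ∀ b ∈ F, a < b → (∀ t ∈ F, a < t → ¬ t < b) → γ a = γ b

theorem exists_minimal_gapSet {X : Type*} [MetricSpace X] (γ : ℝ → X) (hγ : Continuous γ) :
    ∃ F, Minimal (GapSet γ) F := by
  obtain ⟨F, -, hF⟩ := zorn_superset_nonempty {F | GapSet γ F} (by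
    intro T hT hch hne
    have hsub : ∀ F ∈ T, ⋂₀ T ⊆ F := fun F hF => sInter_subset_of_mem hF
    obtain ⟨F0, hF0⟩ := hne
    refine ⟨⋂₀ T, ⟨isClosed_sInter fun s hs => (hT hs).1, (hsub F0 hF0).trans (hT hF0).2.1,
      fun s hs => (hT hs).2.2.1, fun s hs => (hT hs).2.2.2.1, ?_⟩, hsub⟩
    intro a ha b hb hab hgap
    by_contra hne
    have hη : 0 < dist (γ a) (γ b) / 2 := half_pos (dist_pos.2 hne)
    obtain ⟨δ1, hδ1, h1⟩ := Metric.continuous_iff.1 hγ a _ hη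
    obtain ⟨δ2, hδ2, h2⟩ := Metric.continuous_iff.1 hγ b _ hη
    obtain ⟨δ, hδ, hd⟩ : ∃ δ > 0, δ < δ1 ∧ δ < δ2 ∧ δ < (b - a) / 2 := by
      have hm : 0 < min δ1 (min δ2 ((b - a) / 2)) :=
        lt_min hδ1 (lt_min hδ2 (by linarith))
      refine ⟨min δ1 (min δ2 ((b - a) / 2)) / 2, half_pos hm, ?_, ?_, ?_⟩
      · exact (half_lt_self hm).trans_le (min_le_left _ _)
      · exact (half_lt_self hm).trans_le ((min_le_right _ _).trans (min_le_left _ _))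
      · exact (half_lt_self hm).trans_le ((min_le_right _ _).trans (min_le_right _ _))
    obtain ⟨hd1, hd2, hd3⟩ := hd
    obtain ⟨F, hFT, hFe⟩ : ∃ F ∈ T, ∀ t ∈ F, t ∉ Icc (a + δ) (b - δ) := by
      by_contra hcon
      push Not at hcon
      have : Nonempty T := ⟨⟨F0, hF0⟩⟩
      have := IsCompact.nonempty_iInter_of_directed_nonempty_isCompact_isClosed
        (fun F : T => (F : Set ℝ) ∩ Icc (a + δ) (b - δ))
        (fun A B => (hch.total A.2 B.2).elim
          (fun h => ⟨A, subset_rfl, inter_subset_inter_left _ h⟩)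
          (fun h => ⟨B, inter_subset_inter_left _ h, subset_rfl⟩))
        (fun A => by
          obtain ⟨t, ht, ht'⟩ := hcon A A.2
          exact ⟨t, ht, ht'⟩)
        (fun A => isCompact_Icc.inter_left (hT A.2).1)
        (fun A => (hT A.2).1.inter isClosed_Icc)
      obtain ⟨t, ht⟩ := this
      rw [mem_iInter] at ht
      have hbd := (ht ⟨F0, hF0⟩).2
      refine hgap t (fun A hA => (ht ⟨A, hA⟩).1) ?_ ?_
      · linarith [hbd.1]
      · linarith [hbd.2]
    obtain ⟨a', ⟨ha'F, ha'⟩, hmax⟩ := (isCompact_Icc.inter_left (hT hFT).1).exists_isGreatest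
      (s := F ∩ Icc a (a + δ)) ⟨a, hsub F hFT ha, le_rfl, by linarith⟩
    obtain ⟨b', ⟨hb'F, hb'⟩, hmin⟩ := (isCompact_Icc.inter_left (hT hFT).1).exists_isLeast
      (s := F ∩ Icc (b - δ) b) ⟨b, hsub F hFT hb, by linarith, le_rfl⟩
    have hab' : a' < b' := by linarith [ha'.2, hb'.1]
    have he := (hT hFT).2.2.2.2 a' ha'F b' hb'F hab' (by
      intro t ht hat htb
      rcases le_or_gt t (a + δ) with h | h
      · exact absurd (hmax ⟨ht, ha'.1.trans hat.le, h⟩) (not_le.2 hat)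
      · rcases le_or_gt (b - δ) t with h' | h'
        · exact absurd (hmin ⟨ht, h', htb.le.trans hb'.2⟩) (not_le.2 htb)
        · exact hFe t ht ⟨h.le, h'.le⟩)
    have k1 := h1 a' (by rw [Real.dist_eq, abs_lt]; constructor <;> linarith [ha'.1, ha'.2])
    have k2 := h2 b' (by rw [Real.dist_eq, abs_lt]; constructor <;> linarith [hb'.1, hb'.2])
    rw [he] at k1
    have := dist_triangle_left (γ a) (γ b) (γ b')
    linarith) (Icc 0 1)
    ⟨isClosed_Icc, subset_rfl, by simp, by simp, by
      intro a ha b hb hab h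
      exact absurd (by linarith : (a + b) / 2 < b)
        (h ((a + b) / 2) ⟨by linarith [ha.1], by linarith [hb.2]⟩ (by linarith))⟩
  exact ⟨F, hF⟩

theorem minimal_gapSet_inj {X : Type*} (γ : ℝ → X) {F : Set ℝ}
    (hF : Minimal (GapSet γ) F) {s t : ℝ} (hs : s ∈ F) (ht : t ∈ F) (he : γ s = γ t) :
    ∀ u ∈ F, s < u → ¬ u < t := by
  intro u hu hsu hut
  obtain ⟨h1, h2, h3, h4, h5⟩ := hF.prop
  have hG : GapSet γ (F \ Ioo s t) := by
    refine ⟨h1.sdiff isOpen_Ioo, sdiff_subset.trans h2, ⟨h3, fun h => ?_⟩, ⟨h4, fun h => ?_⟩, ?_⟩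
    · linarith [h.1, (h2 hs).1]
    · linarith [h.2, (h2 ht).2]
    · rintro a ⟨ha, ha'⟩ b ⟨hb, hb'⟩ hab hgap
      have hs' := hgap s ⟨hs, fun h => lt_irrefl _ h.1⟩
      have ht' := hgap t ⟨ht, fun h => lt_irrefl _ h.2⟩
      by_cases hc : s ≤ a ∧ b ≤ t
      · have ea : a = s := by
          by_contra hn
          exact ha' ⟨lt_of_le_of_ne hc.1 (Ne.symm hn), hab.trans_le hc.2⟩
        have eb : b = t := by
          by_contra hn
          exact hb' ⟨hc.1.trans_lt hab, lt_of_le_of_ne hc.2 hn⟩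
        rw [ea, eb, he]
      · refine h5 a ha b hb hab fun w hw haw hwb => ?_
        refine hgap w ⟨hw, fun hwst => ?_⟩ haw hwb
        apply hc
        constructor
        · by_contra hlt
          push Not at hlt
          exact hs' hlt (hwst.1.trans hwb)
        · by_contra hlt
          push Not at hlt
          exact ht' (haw.trans hwst.2) hlt
  have := hF.le_of_le hG sdiff_subset
  exact (this hu).2 ⟨hsu, hut⟩

theorem exists_monotone_path {X : Type*} [MetricSpace X] (γ : ℝ → X) (hγ : Continuous γ) :
    ∃ σ : ℝ → X, Continuous σ ∧ σ 0 = γ 0 ∧ σ 1 = γ 1 ∧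
      (∀ t, ∃ s ∈ Icc (0 : ℝ) 1, σ t = γ s) ∧
      ∀ s ∈ Icc (0 : ℝ) 1, ∀ t ∈ Icc (0 : ℝ) 1, σ s = σ t →
        ∀ u, s ≤ u → u ≤ t → σ u = σ s := by
  obtain ⟨F, hF⟩ := exists_minimal_gapSet γ hγ
  have hinj := fun {s t : ℝ} => minimal_gapSet_inj γ hF (s := s) (t := t)
  obtain ⟨h1, h2, h3, h4, h5⟩ := hF.prop
  have hp : ∀ t : Icc (0 : ℝ) 1, ∃ p, IsGreatest (F ∩ Icc 0 (t : ℝ)) p := fun t =>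
    (isCompact_Icc.inter_left h1).exists_isGreatest ⟨0, h3, le_rfl, t.2.1⟩
  choose p hp using hp
  have hpm : ∀ s t : Icc (0 : ℝ) 1, (s : ℝ) ≤ t → p s ≤ p t := fun s t hst =>
    (hp t).2 ⟨(hp s).1.1, (hp s).1.2.1, (hp s).1.2.2.trans hst⟩
  have hpF : ∀ t : Icc (0 : ℝ) 1, (t : ℝ) ∈ F → p t = t := fun t ht =>
    le_antisymm (hp t).1.2.2 ((hp t).2 ⟨ht, t.2.1, le_rfl⟩)
  let g : Icc (0 : ℝ) 1 → X := fun t => γ (p t)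
  have hg : ∀ s t : Icc (0 : ℝ) 1, (s : ℝ) ≤ t → g s = g t ∨
      ∃ r ∈ Icc (s : ℝ) t, ∃ r' ∈ Icc (s : ℝ) t, g s = γ r ∧ g t = γ r' := by
    intro s t hst
    by_cases hem : (F ∩ Icc (s : ℝ) t).Nonempty
    · right
      obtain ⟨r, ⟨hrF, hr⟩, hrmin⟩ := (isCompact_Icc.inter_left h1).exists_isLeast hem
      refine ⟨r, hr, p t, ⟨?_, (hp t).1.2.2⟩, ?_, rfl⟩
      · exact hr.1.trans ((hp t).2 ⟨hrF, s.2.1.trans hr.1, hr.2⟩)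
      · have hps := (hp s).1
        rcases (hps.2.2.trans hr.1).eq_or_lt with e | e
        · simp only [g, e]
        · refine h5 _ hps.1 _ hrF e fun w hw hw1 hw2 => ?_
          rcases le_total w s with h | h
          · exact absurd ((hp s).2 ⟨hw, hps.2.1.trans hw1.le, h⟩) (not_le.2 hw1)
          · exact absurd (hrmin ⟨hw, h, hw2.le.trans hr.2⟩) (not_le.2 hw2)
    · left
      have : p s = p t := by
        refine le_antisymm (hpm s t hst) ((hp s).2 ⟨(hp t).1.1, (hp t).1.2.1, ?_⟩)
        by_contra hlt
        push Not at hlt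
        exact hem ⟨p t, (hp t).1.1, hlt.le, (hp t).1.2.2⟩
      simp only [g, this]
  have hgc : Continuous g := by
    have hu := isCompact_Icc.uniformContinuousOn_of_continuous
      (s := Icc (0 : ℝ) 1) hγ.continuousOn
    rw [Metric.uniformContinuousOn_iff] at hu
    refine Metric.continuous_iff.2 fun t ε hε => ?_
    obtain ⟨δ, hδ, hu⟩ := hu ε hε
    refine ⟨δ, hδ, fun s hst => ?_⟩
    have key : ∀ s t : Icc (0 : ℝ) 1, (s : ℝ) ≤ t → dist s t < δ → dist (g s) (g t) < ε := by
      intro s t hle hst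
      rcases hg s t hle with e | ⟨r, hr, r', hr', e1, e2⟩
      · rw [e, dist_self]; exact hε
      · rw [e1, e2]
        refine hu r ⟨s.2.1.trans hr.1, hr.2.trans t.2.2⟩ r' ⟨s.2.1.trans hr'.1, hr'.2.trans t.2.2⟩ ?_
        rw [Subtype.dist_eq, Real.dist_eq, abs_lt] at hst
        rw [Real.dist_eq, abs_lt]
        constructor <;> linarith [hr.1, hr.2, hr'.1, hr'.2, hst.1, hst.2]
    rcases le_total (s : ℝ) t with h | h
    · exact key s t h hst
    · rw [dist_comm] at hst ⊢
      exact key t s h hst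
  refine ⟨IccExtend zero_le_one g, hgc.Icc_extend', ?_, ?_, ?_, ?_⟩
  · rw [IccExtend_of_mem zero_le_one g (show (0 : ℝ) ∈ Icc 0 1 by simp)]
    simp only [g]; rw [hpF _ h3]
  · rw [IccExtend_of_mem zero_le_one g (show (1 : ℝ) ∈ Icc 0 1 by simp)]
    simp only [g]; rw [hpF _ h4]
  · intro t
    exact ⟨_, h2 (hp (projIcc 0 1 zero_le_one t)).1.1, rfl⟩
  · intro s hs t ht he u hsu hut
    have hu : u ∈ Icc (0 : ℝ) 1 := ⟨hs.1.trans hsu, hut.trans ht.2⟩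
    rw [IccExtend_of_mem _ g hs, IccExtend_of_mem _ g ht] at he
    rw [IccExtend_of_mem _ g hs, IccExtend_of_mem _ g hu]
    have k1 := hpm ⟨s, hs⟩ ⟨u, hu⟩ hsu
    have k2 := hpm ⟨u, hu⟩ ⟨t, ht⟩ hut
    have k3 := hinj (hp ⟨s, hs⟩).1.1 (hp ⟨t, ht⟩).1.1 he _ (hp ⟨u, hu⟩).1.1
    rcases k1.eq_or_lt with e | e
    · simp only [g, e]
    · have : p ⟨u, hu⟩ = p ⟨t, ht⟩ := le_antisymm k2 (not_lt.1 (k3 e))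
      rw [he]
      simp only [g, this]

end TorsDend

namespace TorsDend

theorem exists_arc {X : Type*} [MetricSpace X] [TopologicalSpace.SeparableSpace X] {a b : X}
    (hab : a ≠ b) {U : Set X} (h : JoinedIn U a b) :
    ∃ e : ℝ → X, Continuous e ∧ InjOn e (Icc 0 1) ∧ e 0 = a ∧ e 1 = b ∧ ∀ t, e t ∈ U := by
  obtain ⟨γ, hγ⟩ := h
  obtain ⟨σ, h1, h2, h3, h4, h5⟩ := exists_monotone_path γ.extend γ.continuous_extend
  rw [γ.extend_zero] at h2
  rw [γ.extend_one] at h3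
  obtain ⟨e, e1, e2, e3, e4, e5⟩ := arc_of_monotone σ h1 (by rw [h2, h3]; exact hab) h5
  refine ⟨e, e1, e2, e3.trans h2, e4.trans h3, fun t => ?_⟩
  obtain ⟨s, -, hs⟩ := e5 t
  obtain ⟨r, hr, hr'⟩ := h4 s
  rw [hs, hr', γ.extend_apply hr]
  exact hγ _

/-- In a dendrite, any two distinct points are separated by a third point. -/
theorem exists_sep {X : Type*} [MetricSpace X] [CompactSpace X] [ConnectedSpace X]
    [LocallyConnectedSpace X] (hno : ¬ ∃ S : Set X, Nonempty (S ≃ₜ Circle)) (x y : X)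
    (hxy : x ≠ y) : ∃ c, c ≠ x ∧ c ≠ y ∧ y ∉ connectedComponentIn {c}ᶜ x := by
  by_contra hcon
  push Not at hcon
  have : LocallyPathConnectedSpace X := locPath
  have hjoin : ∀ U : Set X, IsOpen U → IsPreconnected U → x ∈ U → y ∈ U → JoinedIn U x y :=
    fun U hU hUc hx hy =>
      (hU.isConnected_iff_isPathConnected.1 ⟨⟨x, hx⟩, hUc⟩).joinedIn x hx y hy
  obtain ⟨A, A1, A2, A3, A4, -⟩ :=
    exists_arc hxy (hjoin univ isOpen_univ isPreconnected_univ trivial trivial)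
  have hhalf : (1 / 2 : ℝ) ∈ Icc (0 : ℝ) 1 := by constructor <;> norm_num
  have hcx : A (1 / 2) ≠ x := by
    rw [← A3]
    intro h
    have := A2 hhalf (by simp) h
    norm_num at this
  have hcy : A (1 / 2) ≠ y := by
    rw [← A4]
    intro h
    have := A2 hhalf (by simp) h
    norm_num at this
  obtain ⟨B, B1, B2, B3, B4, B5⟩ := exists_arc hxy
    (hjoin (connectedComponentIn {A (1 / 2)}ᶜ x) isOpen_compl_singleton.connectedComponentIn
      isPreconnected_connectedComponentIn (mem_connectedComponentIn hcx.symm) (hcon _ hcx hcy))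
  refine hno (circle_of_arcs A B A1 B1 A2 B2 (A3.trans B3.symm) (A4.trans B4.symm) (1 / 2)
    hhalf ?_)
  rintro ⟨t, -, ht⟩
  exact connectedComponentIn_subset _ _ (B5 t) ht

end TorsDend

/-- Any torsion group acting by homeomorphisms on a dendrite has a fixed point. -/
theorem torsion_group_fixed_point (G X : Type*) [Group G] [TopologicalSpace X]
    [MulAction G X] (hcont : ∀ g : G, Continuous fun x : X => g • x)
    (hX : IsDendrite X) (htors : Monoid.IsTorsion G) :
    ∃ x : X, ∀ g : G, g • x = x := by
  obtain ⟨h1, h2, h3, h4, h5, h6⟩ := hX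
  letI : MetricSpace X := TopologicalSpace.metrizableSpaceMetric X
  haveI : ContinuousConstSMul G X := ⟨hcont⟩
  exact TorsDend.fixed_of_sep htors (TorsDend.exists_sep h6)
end

section
/- Let X be a dendrite not reduced to a point. If X has no free arc (no arc with nonempty interior in X whose interior is open), then the set of branch points of X is dense in X. -/
open Set

/-- A branch point: a point whose complement has at least three connected components. -/
def IsBranchPoint (X : Type*) [TopologicalSpace X] (x : X) : Prop :=
  ∃ y₁ y₂ y₃ : X, y₁ ≠ x ∧ y₂ ≠ x ∧ y₃ ≠ x ∧
    connectedComponentIn ({x}ᶜ : Set X) y₁ ≠ connectedComponentIn ({x}ᶜ : Set X) y₂ ∧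
    connectedComponentIn ({x}ᶜ : Set X) y₁ ≠ connectedComponentIn ({x}ᶜ : Set X) y₃ ∧
    connectedComponentIn ({x}ᶜ : Set X) y₂ ≠ connectedComponentIn ({x}ᶜ : Set X) y₃

/-- A free arc: a nondegenerate arc whose interior (the arc minus its endpoints)
is open in `X`. -/
def HasFreeArc (X : Type*) [TopologicalSpace X] : Prop :=
  ∃ f : ℝ → X, ContinuousOn f (Icc 0 1) ∧ InjOn f (Icc 0 1) ∧ IsOpen (f '' Ioo 0 1)


open Filter Topology Metric

/-- Functions on the line whose oscillation towards each point is eventually less than `δ`. -/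
def AlmostCont {X : Type*} [MetricSpace X] (δ : ℝ) (f : ℝ → X) : Prop :=
  ∀ t, ∀ᶠ s in 𝓝 t, dist (f s) (f t) < δ

theorem AlmostCont.glue {X : Type*} [MetricSpace X] {δ : ℝ} {f g : ℝ → X}
    (hf : AlmostCont δ f) (hg : AlmostCont δ g) {m : ℝ} (hm : f m = g m) :
    AlmostCont δ (fun r => if r ≤ m then f r else g r) := by
  intro t
  rcases lt_trichotomy t m with h | h | h
  · filter_upwards [hf t, Iio_mem_nhds h] with s hs hs'
    have hs' : s < m := hs'
    simpa [hs'.le, h.le] using hs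
  · subst h
    filter_upwards [hf t, hg t] with s hs hs'
    by_cases hst : s ≤ t
    · simpa [hst] using hs
    · simpa [hst, hm] using hs'
  · filter_upwards [hg t, Ioi_mem_nhds h] with s hs hs'
    have hs' : m < s := hs'
    simpa [hs'.not_ge, h.not_ge] using hs

theorem almostCont_const {X : Type*} [MetricSpace X] {δ : ℝ} (hδ : 0 < δ) (x : X) :
    AlmostCont δ (fun _ => x) := by
  intro t; simp [hδ]

theorem almostCont_step {X : Type*} [MetricSpace X] {δ : ℝ} (hδ : 0 < δ) {x y : X}
    (hxy : dist x y < δ) (m : ℝ) : AlmostCont δ (fun r => if r ≤ m then x else y) := by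
  intro t
  rcases lt_or_ge m t with h | h
  · filter_upwards [Ioi_mem_nhds h] with s hs'
    have hs' : m < s := hs'
    simpa [hs'.not_ge, h.not_ge] using hδ
  · refine Eventually.of_forall fun s => ?_
    by_cases hst : s ≤ m
    · simpa [hst, h] using hδ
    · simpa [hst, h, dist_comm] using hxy

/-- Inside a preconnected set one can jump along small chains. -/
theorem chain_of_preconnected {X : Type*} [MetricSpace X] {δ : ℝ} (hδ : 0 < δ) {C : Set X}
    (hC : IsPreconnected C) {x y : X} (hx : x ∈ C) (hy : y ∈ C) :
    ∀ s t : ℝ, s < t → ∃ g : ℝ → X, AlmostCont δ g ∧ (∀ r, g r ∈ C) ∧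
      (∀ r ≤ s, g r = x) ∧ (∀ r, t ≤ r → g r = y) := by
  have key := hC.induction₂' (fun x y => x ∈ C → y ∈ C →
    ∀ s t : ℝ, s < t → ∃ g : ℝ → X, AlmostCont δ g ∧ (∀ r, g r ∈ C) ∧
      (∀ r ≤ s, g r = x) ∧ (∀ r, t ≤ r → g r = y)) ?_ ?_ hx hy
  · exact key hx hy
  · have base : ∀ x y : X, dist x y < δ → x ∈ C → y ∈ C →
      ∀ s t : ℝ, s < t → ∃ g : ℝ → X, AlmostCont δ g ∧ (∀ r, g r ∈ C) ∧
      (∀ r ≤ s, g r = x) ∧ (∀ r, t ≤ r → g r = y) := by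
      intro x y hxy hx hy s t hst
      refine ⟨_, almostCont_step hδ hxy s, fun r => ?_, fun r hr => by simp [hr], fun r hr => ?_⟩
      · split_ifs <;> assumption
      · simp [(hst.trans_le hr).not_ge]
    intro x hx
    filter_upwards [mem_nhdsWithin_of_mem_nhds (Metric.ball_mem_nhds x hδ)] with y hy
    exact ⟨base x y (by rwa [dist_comm]), base y x hy⟩
  · intro x y z hx hy hz hxy hyz _ _ s t hst
    obtain ⟨g₁, h1, h2, h3, h4⟩ := hxy hx hy s ((s + t) / 2) (by linarith)
    obtain ⟨g₂, k1, k2, k3, k4⟩ := hyz hy hz ((s + t) / 2) t (by linarith)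
    refine ⟨_, h1.glue k1 (m := (s + t) / 2) (by rw [h4 _ le_rfl, k3 _ le_rfl]), ?_, ?_, ?_⟩
    · intro r; split_ifs
      · exact h2 r
      · exact k2 r
    · intro r hr
      rw [if_pos (by linarith), h3 r hr]
    · intro r hr
      rw [if_neg (by linarith), k4 r hr]

/-- Uniform local connectedness at scales `δ`, `ε`. -/
def ULC (X : Type*) [MetricSpace X] (δ ε : ℝ) : Prop :=
  ∀ x y : X, dist x y < δ → ∃ C : Set X, IsPreconnected C ∧ x ∈ C ∧ y ∈ C ∧
    ∀ z ∈ C, ∀ w ∈ C, dist z w < ε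

theorem exists_ULC (X : Type*) [MetricSpace X] [CompactSpace X] [LocallyConnectedSpace X]
    {ε : ℝ} (hε : 0 < ε) : ∃ δ > 0, ULC X δ ε := by
  have h : ∀ x : X, ∃ V : Set X, V ⊆ ball x (ε / 2) ∧ IsOpen V ∧ x ∈ V ∧ IsConnected V :=
    fun x => locallyConnectedSpace_iff_subsets_isOpen_isConnected.1 inferInstance x _
      (ball_mem_nhds x (by linarith))
  choose V h1 h2 h3 h4 using h
  obtain ⟨δ, hδ, H⟩ := lebesgue_number_lemma_of_metric (isCompact_univ (X := X)) h2
    (fun x _ => mem_iUnion.2 ⟨x, h3 x⟩)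
  refine ⟨δ, hδ, fun x y hxy => ?_⟩
  obtain ⟨i, hi⟩ := H x trivial
  refine ⟨V i, (h4 i).isPreconnected, hi (mem_ball_self hδ), hi (by rwa [mem_ball, dist_comm]), ?_⟩
  intro z hz w hw
  have a := mem_ball.1 (h1 i hz)
  have b := mem_ball.1 (h1 i hw)
  have := dist_triangle_right z w i
  linarith

theorem refine_step {X : Type*} [MetricSpace X] {δ ε δ' : ℝ} (hδ : 0 < δ) (hε : 0 < ε)
    (hδ' : 0 < δ') (hU : ULC X δ ε) {f : ℝ → X} (hf : AlmostCont δ f) :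
    ∃ g : ℝ → X, AlmostCont δ' g ∧ (∀ r ≤ 0, g r = f 0) ∧ (∀ r, 1 ≤ r → g r = f 1) ∧
      ∀ r ∈ Icc (0:ℝ) 1, dist (f r) (g r) ≤ ε + δ := by
  let J : ℝ → ℝ → Prop := fun s t => ∃ g : ℝ → X, AlmostCont δ' g ∧ (∀ r ≤ s, g r = f s) ∧
    (∀ r, t ≤ r → g r = f t) ∧ ∀ r ∈ Icc s t, dist (f r) (g r) ≤ ε + δ
  have Jrefl : ∀ s, J s s := fun s => ⟨fun _ => f s, almostCont_const hδ' _, fun _ _ => rfl,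
    fun _ _ => rfl, fun r hr => by
      have : r = s := le_antisymm hr.2 hr.1
      simp [this]; positivity⟩
  have Jtrans : ∀ s t u, s ≤ t → t ≤ u → J s t → J t u → J s u := by
    rintro s t u hst htu ⟨g₁, h1, h2, h3, h4⟩ ⟨g₂, k1, k2, k3, k4⟩
    refine ⟨_, h1.glue k1 (m := t) (by rw [h3 _ le_rfl, k2 _ le_rfl]), ?_, ?_, ?_⟩
    · intro r hr
      rw [if_pos (by linarith), h2 r hr]
    · intro r hr
      split_ifs with h
      · have e1 : r = t := by linarith
        have e2 : t = u := by linarith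
        subst e1; subst e2
        exact h3 _ le_rfl
      · exact k3 r hr
    · intro r hr
      split_ifs with h
      · exact h4 r ⟨hr.1, h⟩
      · exact k4 r ⟨by linarith, hr.2⟩
  have Jbase : ∀ s t c, s ≤ t → (∀ r ∈ Icc s t, dist (f r) (f c) < δ) → (c = s ∨ c = t) →
      J s t := by
    intro s t c hst hr hc
    rcases hst.eq_or_lt with rfl | hst'
    · exact Jrefl _
    have hd : dist (f s) (f t) < δ := by
      rcases hc with rfl | rfl
      · rw [dist_comm]; exact hr _ ⟨hst, le_rfl⟩
      · exact hr _ ⟨le_rfl, hst⟩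
    obtain ⟨C, hC, hs, ht, hd⟩ := hU _ _ hd
    obtain ⟨g, h1, h2, h3, h4⟩ := chain_of_preconnected hδ' hC hs ht s t hst'
    refine ⟨g, h1, h3, h4, fun r hr' => ?_⟩
    have hcC : f c ∈ C := by rcases hc with rfl | rfl <;> assumption
    have a := hd _ hcC _ (h2 r)
    have b := hr r hr'
    have := dist_triangle (f r) (f c) (g r)
    linarith
  have Jloc : ∀ c, ∃ η > 0, (∀ s, c - η < s → s ≤ c → J s c) ∧
      (∀ s, c ≤ s → s < c + η → J c s) := by
    intro c
    obtain ⟨η, hη, H⟩ := Metric.eventually_nhds_iff.1 (hf c)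
    refine ⟨η, hη, fun s hs hsc => Jbase s c c hsc (fun r hr => H ?_) (Or.inr rfl),
      fun s hs hsc => Jbase c s c hs (fun r hr => H ?_) (Or.inl rfl)⟩
    · rw [Real.dist_eq, abs_lt]; constructor <;> linarith [hr.1, hr.2]
    · rw [Real.dist_eq, abs_lt]; constructor <;> linarith [hr.1, hr.2]
  suffices J 0 1 from this
  let S : Set ℝ := {t | t ∈ Icc (0:ℝ) 1 ∧ J 0 t}
  have h0 : (0:ℝ) ∈ S := ⟨⟨le_rfl, zero_le_one⟩, Jrefl 0⟩
  have hb : BddAbove S := ⟨1, fun t ht => ht.1.2⟩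
  have hc0 : 0 ≤ sSup S := le_csSup hb h0
  have hc1 : sSup S ≤ 1 := csSup_le ⟨0, h0⟩ fun t ht => ht.1.2
  obtain ⟨η, hη, H1, H2⟩ := Jloc (sSup S)
  obtain ⟨s, hs, hs'⟩ := exists_lt_of_lt_csSup ⟨0, h0⟩ (show sSup S - η < sSup S by linarith)
  have hsS := le_csSup hb hs
  have hJc : J 0 (sSup S) := Jtrans 0 s _ hs.1.1 hsS hs.2 (H1 s hs' hsS)
  rcases hc1.eq_or_lt with h | h
  · rwa [h] at hJc
  exfalso
  have hlt : sSup S < min 1 (sSup S + η / 2) := lt_min h (by linarith)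
  have : min 1 (sSup S + η / 2) ∈ S := by
    refine ⟨⟨by linarith, min_le_left _ _⟩, Jtrans 0 _ _ hc0 hlt.le hJc (H2 _ hlt.le ?_)⟩
    exact (min_le_right _ _).trans_lt (by linarith)
  linarith [le_csSup hb this]

theorem exists_small_path (X : Type*) [MetricSpace X] [CompactSpace X] [LocallyConnectedSpace X]
    {ε : ℝ} (hε : 0 < ε) : ∃ δ > 0, ∀ x y : X, dist x y < δ → JoinedIn (ball x ε) x y := by
  have hex : ∀ n : ℕ, ∃ δ > 0, δ ≤ ε / 16 * (1 / 2) ^ n ∧ ULC X δ (ε / 16 * (1 / 2) ^ n) := by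
    intro n
    obtain ⟨δ, hδ, h⟩ := exists_ULC X (show 0 < ε / 16 * (1 / 2) ^ n by positivity)
    exact ⟨min δ (ε / 16 * (1 / 2) ^ n), lt_min hδ (by positivity), min_le_right _ _,
      fun x y hxy => h x y (hxy.trans_le (min_le_left _ _))⟩
  choose δ hδ hδε hU using hex
  refine ⟨δ 0, hδ 0, fun x y hxy => ?_⟩
  let P : ℕ → (ℝ → X) → Prop := fun n f => AlmostCont (δ n) f ∧ (∀ r ≤ 0, f r = x) ∧
    (∀ r, 1 ≤ r → f r = y)
  have hstep : ∀ n (f : {f // P n f}), ∃ g : {g // P (n + 1) g},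
      ∀ r, dist (f.1 r) (g.1 r) ≤ ε / 8 * (1 / 2) ^ n := by
    rintro n ⟨f, h1, h2, h3⟩
    obtain ⟨g, g1, g2, g3, g4⟩ := refine_step (hδ n) (by positivity) (hδ (n + 1)) (hU n) h1
    rw [h2 0 le_rfl] at g2
    rw [h3 1 le_rfl] at g3
    refine ⟨⟨g, g1, g2, g3⟩, fun r => ?_⟩
    have hpos : 0 ≤ ε / 8 * (1 / 2) ^ n := by positivity
    simp only
    rcases le_total r 0 with h | h
    · rw [h2 r h, g2 r h, dist_self]; exact hpos
    rcases le_total 1 r with h' | h'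
    · rw [h3 r h', g3 r h', dist_self]; exact hpos
    have := g4 r ⟨h, h'⟩
    linarith [hδε n]
  choose G hG using hstep
  have f0 : P 0 (fun r => if r ≤ 0 then x else y) :=
    ⟨almostCont_step (hδ 0) hxy 0, fun r hr => by simp [hr],
      fun r hr => by simp [(zero_lt_one.trans_le hr).not_ge]⟩
  let F : ∀ n, {f // P n f} := fun n => Nat.rec ⟨_, f0⟩ G n
  have hF : ∀ r n, dist ((F n).1 r) ((F (n + 1)).1 r) ≤ ε / 8 * (1 / 2) ^ n :=
    fun r n => hG n (F n) r
  have hlim : ∀ r, ∃ z, Tendsto (fun n => (F n).1 r) atTop (𝓝 z) := fun r =>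
    cauchySeq_tendsto_of_complete (cauchySeq_of_le_geometric _ _ (by norm_num) (hF r))
  choose f hf using hlim
  have hdist : ∀ r n, dist ((F n).1 r) (f r) ≤ ε / 4 * (1 / 2) ^ n := by
    intro r n
    have := dist_le_of_le_geometric_of_tendsto _ _ (by norm_num) (hF r) (hf r) n
    refine this.trans (le_of_eq ?_)
    ring
  have hfx : ∀ r ≤ 0, f r = x := fun r hr => tendsto_nhds_unique (hf r) (by
    simp only [fun n => (F n).2.2.1 r hr]; exact tendsto_const_nhds)
  have hfy : ∀ r, 1 ≤ r → f r = y := fun r hr => tendsto_nhds_unique (hf r) (by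
    simp only [fun n => (F n).2.2.2 r hr]; exact tendsto_const_nhds)
  have hcont : Continuous f := by
    rw [continuous_iff_continuousAt]
    intro t
    rw [ContinuousAt, Metric.tendsto_nhds]
    intro e he
    have : Tendsto (fun n : ℕ => ε * (1 / 2 : ℝ) ^ n) atTop (𝓝 (ε * 0)) :=
      (tendsto_pow_atTop_nhds_zero_of_lt_one (by norm_num) (by norm_num)).const_mul _
    rw [mul_zero] at this
    obtain ⟨n, hn⟩ := (this.eventually (gt_mem_nhds he)).exists
    filter_upwards [(F n).2.1 t] with s hs
    have a := hdist s n
    have b := hdist t n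
    have c := dist_triangle4 (f s) ((F n).1 s) ((F n).1 t) (f t)
    rw [dist_comm (f s) ((F n).1 s)] at c
    have d := hδε n
    have : 0 < (1 / 2 : ℝ) ^ n := by positivity
    nlinarith
  refine ⟨⟨⟨fun t => f t, hcont.comp continuous_subtype_val⟩, hfx _ le_rfl, hfy _ le_rfl⟩, ?_⟩
  intro t
  have a := hdist t 0
  have b : dist ((F 0).1 t) x < ε / 8 := by
    change dist (if (t : ℝ) ≤ 0 then x else y) x < ε / 8
    have h0 := hδε 0
    simp only [pow_zero, mul_one] at h0
    split_ifs
    · simp [hε]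
    · rw [dist_comm]; linarith
  have c := dist_triangle_left (f t) x ((F 0).1 t)
  rw [mem_ball]
  simp only [pow_zero, mul_one] at a
  change dist (f t) x < ε
  linarith

theorem locallyPathConnected_of_compact (X : Type*) [MetricSpace X] [CompactSpace X]
    [LocallyConnectedSpace X] : LocallyPathConnectedSpace X := by
  rw [locallyPathConnectedSpace_iff_pathComponentIn_mem_nhds]
  intro x u hu hx
  obtain ⟨ε, hε, h⟩ := Metric.isOpen_iff.1 hu x hx
  obtain ⟨δ, hδ, H⟩ := exists_small_path X hε
  filter_upwards [ball_mem_nhds x hδ] with y hy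
  exact (H x y (by rwa [dist_comm])).mono h

/-- A continuous curve with interval fibres can be reparametrized to an injective one. -/
theorem arc_of_interval_fibres {X : Type*} [MetricSpace X] [CompactSpace X] {g : ℝ → X}
    (hg : Continuous g)
    (hfib : ∀ x y z, 0 ≤ x → x ≤ z → z ≤ y → y ≤ 1 → g x = g y → g z = g x) (h01 : g 0 ≠ g 1) :
    ∃ γ : ℝ → X, ContinuousOn γ (Icc 0 1) ∧ InjOn γ (Icc 0 1) ∧ γ 0 = g 0 ∧ γ 1 = g 1 ∧
      ∀ t ∈ Icc (0:ℝ) 1, ∃ s ∈ Icc (0:ℝ) 1, γ t = g s := by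
  let h : ℝ → ℝ → ℝ := fun q x => sSup ((fun t : ℝ => dist (g t) (g q)) '' Icc q (max x q))
  obtain ⟨D, hD⟩ : ∃ D : ℝ, ∀ x y : X, dist x y ≤ D :=
    ⟨diam (univ : Set X), fun x y => dist_le_diam_of_mem isCompact_univ.isBounded trivial trivial⟩
  have hbdd : ∀ q x, BddAbove ((fun t : ℝ => dist (g t) (g q)) '' Icc q (max x q)) := by
    rintro q x; refine ⟨D, ?_⟩; rintro _ ⟨t, -, rfl⟩; exact hD _ _
  have hne : ∀ q x, ((fun t : ℝ => dist (g t) (g q)) '' Icc q (max x q)).Nonempty :=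
    fun q x => ⟨_, q, ⟨le_rfl, le_max_right _ _⟩, rfl⟩
  have hnn : ∀ q x, 0 ≤ h q x := fun q x => by
    have := le_csSup (hbdd q x) ⟨q, ⟨le_rfl, le_max_right _ _⟩, rfl⟩
    simpa using this
  have hle : ∀ q x, h q x ≤ D := fun q x => csSup_le (hne q x) (by
    rintro _ ⟨t, -, rfl⟩; exact hD _ _)
  have hmono : ∀ q, Monotone (h q) := fun q x y hxy =>
    csSup_le_csSup (hbdd q y) (hne q x)
      (image_mono (Icc_subset_Icc_right (max_le_max_right _ hxy)))
  have hcont : ∀ q, Continuous (h q) := by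
    intro q
    have e : h q = fun x => sSup ((fun t : ℝ => dist (g (q + t * (max x q - q))) (g q)) ''
        Icc (0:ℝ) 1) := by
      funext x
      refine congrArg sSup ?_
      ext v
      constructor
      · rintro ⟨t, ht, rfl⟩
        rcases (le_max_right x q).eq_or_lt with hq | hq
        · refine ⟨0, by simp, ?_⟩
          have : t = q := le_antisymm (by rw [hq]; exact ht.2) ht.1
          simp [this]
        · have hpos : 0 < max x q - q := by linarith
          refine ⟨(t - q) / (max x q - q), ⟨div_nonneg (by linarith [ht.1]) hpos.le,
            (div_le_one hpos).2 (by linarith [ht.2])⟩, ?_⟩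
          simp only
          rw [div_mul_cancel₀ _ hpos.ne']
          simp
      · rintro ⟨t, ht, rfl⟩
        have hpos : 0 ≤ max x q - q := by linarith [le_max_right x q]
        refine ⟨_, ⟨?_, ?_⟩, rfl⟩
        · nlinarith [ht.1]
        · nlinarith [ht.2]
    rw [e]
    apply isCompact_Icc.continuous_sSup (f := fun x t : ℝ => dist (g (q + t * (max x q - q))) (g q))
    simp only [Function.HasUncurry.uncurry]
    fun_prop
  have hconst : ∀ q x y, 0 ≤ x → x ≤ y → y ≤ 1 → g x = g y → h q x = h q y := by
    intro q x y hx hxy hy hgxy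
    refine le_antisymm (hmono q hxy) (csSup_le (hne q y) ?_)
    rintro _ ⟨u, hu, rfl⟩
    rcases le_or_gt u (max x q) with hux | hux
    · exact le_csSup (hbdd q x) ⟨u, ⟨hu.1, hux⟩, rfl⟩
    · have h1 : x < u := (le_max_left _ _).trans_lt hux
      have h2 : q < u := (le_max_right _ _).trans_lt hux
      have h3 : u ≤ y := by
        rcases le_max_iff.1 hu.2 with h | h
        · exact h
        · linarith
      have e1 := hfib x y u hx h1.le h3 hy hgxy
      have e2 := hfib x y (max x q) hx (le_max_left _ _) (hux.le.trans h3) hy hgxy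
      refine le_csSup (hbdd q x) ⟨max x q, ⟨le_max_right _ _, le_rfl⟩, ?_⟩
      simp only [e1, e2]
  obtain ⟨q, hq⟩ := TopologicalSpace.exists_dense_seq ℝ
  let φ : ℝ → ℝ := fun x => ∑' n, (1 / 2 : ℝ) ^ n * h (q n) x
  have hbound : ∀ n x, ‖(1 / 2 : ℝ) ^ n * h (q n) x‖ ≤ (1 / 2 : ℝ) ^ n * D := by
    intro n x
    rw [Real.norm_of_nonneg (mul_nonneg (by positivity) (hnn _ _))]
    exact mul_le_mul_of_nonneg_left (hle _ _) (by positivity)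
  have hsD : Summable fun n : ℕ => (1 / 2 : ℝ) ^ n * D := summable_geometric_two.mul_right D
  have hsum : ∀ x, Summable fun n => (1 / 2 : ℝ) ^ n * h (q n) x := fun x =>
    Summable.of_norm_bounded hsD (fun n => hbound n x)
  have φcont : Continuous φ := continuous_tsum
    (fun n => continuous_const.mul (hcont (q n))) hsD hbound
  have φmono : Monotone φ := fun x y hxy => (hsum x).tsum_le_tsum
    (fun n => mul_le_mul_of_nonneg_left (hmono _ hxy) (by positivity)) (hsum y)
  have φconst : ∀ x y, 0 ≤ x → x ≤ y → y ≤ 1 → g x = g y → φ x = φ y := by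
    intro x y hx hxy hy hgxy
    simp only [φ]
    congr 1; funext n; rw [hconst (q n) x y hx hxy hy hgxy]
  have φlt : ∀ x y, x < y → g x ≠ g y → φ x < φ y := by
    intro x y hxy hgxy
    have hopen : IsOpen ({t | g t ≠ g y}) := isOpen_ne_fun hg continuous_const
    obtain ⟨η, hη, hball⟩ := Metric.isOpen_iff.1 hopen x hgxy
    obtain ⟨n, hn⟩ := hq.exists_mem_open (isOpen_Ioo (a := x) (b := min y (x + η)))
      (nonempty_Ioo.2 (lt_min hxy (by linarith)))
    have hn2 := lt_min_iff.1 hn.2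
    have hqn : g (q n) ≠ g y := hball (by
      rw [mem_ball, Real.dist_eq, abs_lt]; constructor <;> linarith [hn.1])
    refine Summable.tsum_lt_tsum (i := n)
      (fun n => mul_le_mul_of_nonneg_left (hmono _ hxy.le) (by positivity)) ?_ (hsum x) (hsum y)
    refine mul_lt_mul_of_pos_left ?_ (by positivity)
    have h1 : h (q n) x ≤ 0 := by
      refine csSup_le (hne _ _) ?_
      rintro _ ⟨u, hu, rfl⟩
      rw [max_eq_right hn.1.le] at hu
      have : u = q n := le_antisymm hu.2 hu.1
      simp [this]
    have h2 : dist (g y) (g (q n)) ≤ h (q n) y :=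
      le_csSup (hbdd _ _) ⟨y, ⟨hn2.1.le, le_max_left _ _⟩, rfl⟩
    have h3 : 0 < dist (g y) (g (q n)) := dist_pos.2 (Ne.symm hqn)
    linarith
  have φ01 : φ 0 < φ 1 := φlt 0 1 zero_lt_one h01
  have hiff : ∀ x ∈ Icc (0:ℝ) 1, ∀ y ∈ Icc (0:ℝ) 1, (φ x = φ y ↔ g x = g y) := by
    have aux : ∀ x ∈ Icc (0:ℝ) 1, ∀ y ∈ Icc (0:ℝ) 1, x ≤ y → (φ x = φ y ↔ g x = g y) := by
      intro x hx y hy hxy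
      refine ⟨fun h => ?_, φconst x y hx.1 hxy hy.2⟩
      by_contra hne
      rcases hxy.eq_or_lt with rfl | hlt
      · exact hne rfl
      · exact (φlt x y hlt hne).ne h
    intro x hx y hy
    rcases le_total x y with hxy | hxy
    · exact aux x hx y hy hxy
    · rw [eq_comm, aux y hy x hx hxy, eq_comm]
  let ψ : ℝ → ℝ := fun x => (φ x - φ 0) / (φ 1 - φ 0)
  have hpos : 0 < φ 1 - φ 0 := by linarith
  have ψcont : Continuous ψ := (φcont.sub continuous_const).div_const _
  have ψ0 : ψ 0 = 0 := by simp [ψ]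
  have ψ1 : ψ 1 = 1 := div_self hpos.ne'
  have ψeq : ∀ x y, ψ x = ψ y ↔ φ x = φ y := by
    intro x y
    simp only [ψ]
    rw [div_left_inj' hpos.ne', sub_left_inj]
  have ψmono : Monotone ψ := fun x y hxy =>
    div_le_div_of_nonneg_right (by linarith [φmono hxy]) hpos.le
  have hsurj : ∀ t ∈ Icc (0:ℝ) 1, ∃ s ∈ Icc (0:ℝ) 1, ψ s = t := by
    intro t ht
    have := intermediate_value_Icc (zero_le_one' ℝ) ψcont.continuousOn
    rw [ψ0, ψ1] at this
    exact this ht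
  choose! r hr hψr using hsurj
  have hγ : ∀ s ∈ Icc (0:ℝ) 1, g (r (ψ s)) = g s := by
    intro s hs
    have hψs : ψ s ∈ Icc (0:ℝ) 1 := ⟨by rw [← ψ0]; exact ψmono hs.1, by
      rw [← ψ1]; exact ψmono hs.2⟩
    rw [← hiff _ (hr _ hψs) _ hs, ← ψeq, hψr _ hψs]
  refine ⟨fun t => g (r t), ?_, ?_, ?_, ?_, fun t ht => ⟨r t, hr t ht, rfl⟩⟩
  · rw [continuousOn_iff_isClosed]
    intro C hC
    refine ⟨ψ '' (g ⁻¹' C ∩ Icc 0 1),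
      ((isCompact_Icc.inter_left (hC.preimage hg)).image ψcont).isClosed, ?_⟩
    ext t
    constructor
    · rintro ⟨h1, h2⟩
      exact ⟨⟨r t, ⟨h1, hr t h2⟩, hψr t h2⟩, h2⟩
    · rintro ⟨⟨s, ⟨h1, h2⟩, rfl⟩, h3⟩
      refine ⟨?_, h3⟩
      change g (r (ψ s)) ∈ C
      rw [hγ s h2]; exact h1
  · intro t ht t' ht' h
    have := (hiff _ (hr t ht) _ (hr t' ht')).2 h
    rw [← ψeq, hψr t ht, hψr t' ht'] at this
    exact this
  · have := hγ 0 (by simp)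
    rwa [ψ0] at this
  · have := hγ 1 (by simp)
    rwa [ψ1] at this

/-- Closed subsets of the unit interval across whose gaps `f` takes equal values. -/
def GapFamily {X : Type*} (f : ℝ → X) : Set (Set ℝ) :=
  {K | IsClosed K ∧ K ⊆ Icc 0 1 ∧ (0:ℝ) ∈ K ∧ (1:ℝ) ∈ K ∧
    ∀ s ∈ K, ∀ t ∈ K, s < t → (∀ u ∈ K, ¬ (s < u ∧ u < t)) → f s = f t}

theorem exists_minimal_gapFamily {X : Type*} [MetricSpace X] {f : ℝ → X} (hf : Continuous f) :
    ∃ K, Minimal (· ∈ GapFamily f) K := by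
  have hI : Icc (0:ℝ) 1 ∈ GapFamily f := by
    refine ⟨isClosed_Icc, Subset.rfl, by simp, by simp, fun s hs t ht hst h => ?_⟩
    exact absurd ⟨by linarith, by linarith⟩
      (h ((s + t) / 2) ⟨by linarith [hs.1, ht.1], by linarith [hs.2, ht.2]⟩)
  suffices H : ∀ c ⊆ GapFamily f, IsChain (· ⊆ ·) c → c.Nonempty →
      ∃ lb ∈ GapFamily f, ∀ s ∈ c, lb ⊆ s by
    obtain ⟨K, -, hK⟩ := zorn_superset_nonempty (GapFamily f) H _ hI
    exact ⟨K, hK⟩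
  intro c hc hchain hne
  obtain ⟨K₀, hK₀⟩ := hne
  refine ⟨⋂₀ c, ⟨isClosed_sInter fun K hK => (hc hK).1, (sInter_subset_of_mem hK₀).trans
    (hc hK₀).2.1, fun K hK => (hc hK).2.2.1, fun K hK => (hc hK).2.2.2.1, ?_⟩,
    fun K hK => sInter_subset_of_mem hK⟩
  intro s hs t ht hst hgap
  refine eq_of_forall_dist_le fun ε hε => ?_
  obtain ⟨η₁, hη₁, H₁⟩ := Metric.continuous_iff.1 hf s (ε / 2) (by linarith)
  obtain ⟨η₂, hη₂, H₂⟩ := Metric.continuous_iff.1 hf t (ε / 2) (by linarith)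
  obtain ⟨η, hη, hηa, hηb, hηc⟩ : ∃ η > 0, η < η₁ ∧ η < η₂ ∧ s + η < t - η := by
    have hm : 0 < min (min η₁ η₂) (t - s) := lt_min (lt_min hη₁ hη₂) (by linarith)
    have m1 : min (min η₁ η₂) (t - s) ≤ t - s := min_le_right _ _
    have m2 : min (min η₁ η₂) (t - s) ≤ η₁ := (min_le_left _ _).trans (min_le_left _ _)
    have m3 : min (min η₁ η₂) (t - s) ≤ η₂ := (min_le_left _ _).trans (min_le_right _ _)
    exact ⟨min (min η₁ η₂) (t - s) / 3, by linarith, by linarith, by linarith, by linarith⟩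
  -- some member of the chain misses the middle part
  obtain ⟨K, hK, hKm⟩ : ∃ K ∈ c, ∀ u ∈ K, ¬ (s + η ≤ u ∧ u ≤ t - η) := by
    by_contra hcon
    push Not at hcon
    have : (Icc (s + η) (t - η) ∩ ⋂ K : c, (K : Set ℝ)).Nonempty := by
      have : Nonempty c := ⟨⟨K₀, hK₀⟩⟩
      by_contra hemp
      rw [not_nonempty_iff_eq_empty] at hemp
      obtain ⟨K, hK⟩ := isCompact_Icc.elim_directed_family_closed
        (fun K : c => (K : Set ℝ)) (fun K => (hc K.2).1) hemp
        (by
          intro A B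
          rcases hchain.total A.2 B.2 with h | h
          · exact ⟨A, Subset.rfl, h⟩
          · exact ⟨B, h, Subset.rfl⟩)
      obtain ⟨u, hu, h1, h2⟩ := hcon K K.2
      exact (eq_empty_iff_forall_notMem.1 hK) u ⟨⟨h1, h2⟩, hu⟩
    obtain ⟨u, ⟨h1, h2⟩, hu⟩ := this
    rw [← sInter_eq_iInter] at hu
    exact hgap u hu ⟨by linarith, by linarith⟩
  have hKc : IsClosed K := (hc hK).1
  obtain ⟨u, ⟨huK, hu⟩, humax⟩ := ((isCompact_Icc (a := s) (b := (s + η))).inter_left hKc).exists_isGreatest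
    ⟨s, hs K hK, le_rfl, by linarith⟩
  obtain ⟨v, ⟨hvK, hv⟩, hvmin⟩ := ((isCompact_Icc (a := (t - η)) (b := t)).inter_left hKc).exists_isLeast
    ⟨t, ht K hK, by linarith, le_rfl⟩
  have huv : f u = f v := by
    refine (hc hK).2.2.2.2 u huK v hvK (by linarith [hu.2, hv.1]) ?_
    rintro w hw ⟨h1, h2⟩
    rcases le_or_gt w (s + η) with h3 | h3
    · linarith [humax ⟨hw, ⟨by linarith [hu.1], h3⟩⟩]
    rcases le_or_gt (t - η) w with h4 | h4
    · linarith [hvmin ⟨hw, ⟨h4, by linarith [hv.2]⟩⟩]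
    exact hKm w hw ⟨h3.le, h4.le⟩
  have a := H₁ u (by rw [Real.dist_eq, abs_lt]; constructor <;> linarith [hu.1, hu.2])
  have b := H₂ v (by rw [Real.dist_eq, abs_lt]; constructor <;> linarith [hv.1, hv.2])
  have := dist_triangle_left (f s) (f t) (f u)
  rw [huv] at a this
  linarith

theorem gapFamily_minimal_inj {X : Type*} {f : ℝ → X} {K : Set ℝ}
    (hK : Minimal (· ∈ GapFamily f) K) {x y : ℝ} (hx : x ∈ K) (hy : y ∈ K)
    (_hxy : x < y) (hf : f x = f y) : ∀ u ∈ K, ¬ (x < u ∧ u < y) := by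
  obtain ⟨⟨h1, h2, h3, h4, h5⟩, hmin⟩ := hK
  have hmem : K \ Ioo x y ∈ GapFamily f := by
    refine ⟨h1.sdiff isOpen_Ioo, sdiff_subset.trans h2, ⟨h3, fun h => ?_⟩, ⟨h4, fun h => ?_⟩, ?_⟩
    · linarith [(h2 hx).1, h.1]
    · linarith [(h2 hy).2, h.2]
    · rintro s ⟨hs, hs'⟩ t ⟨ht, ht'⟩ hst hgap
      have hx' := hgap x ⟨hx, fun h => lt_irrefl _ h.1⟩
      have hy' := hgap y ⟨hy, fun h => lt_irrefl _ h.2⟩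
      by_cases hall : ∀ u ∈ K, ¬ (s < u ∧ u < t)
      · exact h5 s hs t ht hst hall
      push Not at hall
      obtain ⟨u, hu, hsu, hut⟩ := hall
      have huxy : u ∈ Ioo x y := by
        by_contra h
        exact hgap u ⟨hu, h⟩ ⟨hsu, hut⟩
      have e1 : s = x := by
        rcases lt_trichotomy s x with h | h | h
        · exact absurd ⟨h, huxy.1.trans hut⟩ hx'
        · exact h
        · exact absurd ⟨h, hsu.trans huxy.2⟩ hs'
      have e2 : t = y := by
        rcases lt_trichotomy t y with h | h | h
        · exact absurd ⟨huxy.1.trans hut, h⟩ ht'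
        · exact h
        · exact absurd ⟨hsu.trans huxy.2, h⟩ hy'
      rw [e1, e2, hf]
  intro u hu hlt
  exact (hmin hmem sdiff_subset hu).2 hlt

theorem arc_of_curve {X : Type*} [MetricSpace X] [CompactSpace X] {f : ℝ → X}
    (hf : Continuous f) (h01 : f 0 ≠ f 1) :
    ∃ γ : ℝ → X, ContinuousOn γ (Icc 0 1) ∧ InjOn γ (Icc 0 1) ∧ γ 0 = f 0 ∧ γ 1 = f 1 ∧
      ∀ t ∈ Icc (0:ℝ) 1, ∃ s ∈ Icc (0:ℝ) 1, γ t = f s := by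
  obtain ⟨K, hK⟩ := exists_minimal_gapFamily hf
  have hinj := fun {x y} => gapFamily_minimal_inj hK (x := x) (y := y)
  obtain ⟨⟨h1, h2, h3, h4, h5⟩, -⟩ := hK
  -- the last point of `K` before `x`
  have hp : ∀ x ∈ Icc (0:ℝ) 1, ∃ p, p ∈ K ∧ p ≤ x ∧ ∀ k ∈ K, k ≤ x → k ≤ p := by
    intro x hx
    obtain ⟨u, ⟨huK, hu⟩, humax⟩ := ((isCompact_Icc (a := 0) (b := x)).inter_left h1).exists_isGreatest
      ⟨0, h3, le_rfl, hx.1⟩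
    exact ⟨u, huK, hu.2, fun k hk hkx => humax ⟨hk, (h2 hk).1, hkx⟩⟩
  choose! p hpK hpx hpmax using hp
  have hpself : ∀ x ∈ K, p x = x := fun x hx =>
    le_antisymm (hpx x (h2 hx)) (hpmax x (h2 hx) x hx le_rfl)
  have hpmono : ∀ x ∈ Icc (0:ℝ) 1, ∀ y ∈ Icc (0:ℝ) 1, x ≤ y → p x ≤ p y := fun x hx y hy hxy =>
    hpmax y hy _ (hpK x hx) ((hpx x hx).trans hxy)
  have hcmp : ∀ x ∈ Icc (0:ℝ) 1, ∀ y ∈ Icc (0:ℝ) 1, x ≤ y → f (p x) = f (p y) ∨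
      ∃ k₁ k₂, x ≤ k₁ ∧ k₁ ≤ y ∧ x ≤ k₂ ∧ k₂ ≤ y ∧ f (p x) = f k₁ ∧ f (p y) = f k₂ := by
    intro x hx y hy hxy
    by_cases hex : (K ∩ Icc x y).Nonempty
    · right
      obtain ⟨k, ⟨hkK, hk⟩, hkmin⟩ := ((isCompact_Icc (a := x) (b := y)).inter_left h1).exists_isLeast hex
      refine ⟨k, p y, hk.1, hk.2, hk.1.trans (hpmax y hy k hkK hk.2), hpx y hy, ?_, rfl⟩
      rcases ((hpx x hx).trans hk.1).eq_or_lt with h | h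
      · rw [h]
      · refine h5 _ (hpK x hx) k hkK h ?_
        rintro u hu ⟨ha, hb⟩
        rcases le_or_gt u x with hux | hux
        · linarith [hpmax x hx u hu hux]
        · linarith [hkmin ⟨hu, hux.le, hb.le.trans hk.2⟩]
    · left
      congr 1
      refine le_antisymm (hpmono x hx y hy hxy) (hpmax x hx _ (hpK y hy) ?_)
      by_contra hlt
      exact hex ⟨p y, hpK y hy, (not_le.1 hlt).le, hpx y hy⟩
  have hgc : ContinuousOn (fun x => f (p x)) (Icc 0 1) := by
    have huc := isCompact_Icc.uniformContinuousOn_of_continuous (s := Icc (0:ℝ) 1) hf.continuousOn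
    refine UniformContinuousOn.continuousOn ?_
    rw [Metric.uniformContinuousOn_iff] at huc ⊢
    intro ε hε
    obtain ⟨δ, hδ, H⟩ := huc ε hε
    refine ⟨δ, hδ, ?_⟩
    have aux : ∀ x ∈ Icc (0:ℝ) 1, ∀ y ∈ Icc (0:ℝ) 1, x ≤ y → dist x y < δ →
        dist (f (p x)) (f (p y)) < ε := by
      intro x hx y hy hxy hd
      rw [Real.dist_eq, abs_lt] at hd
      rcases hcmp x hx y hy hxy with h | ⟨k₁, k₂, a1, a2, a3, a4, a5, a6⟩
      · rw [h, dist_self]; exact hε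
      · rw [a5, a6]
        refine H _ ⟨hx.1.trans a1, a2.trans hy.2⟩ _ ⟨hx.1.trans a3, a4.trans hy.2⟩ ?_
        rw [Real.dist_eq, abs_lt]
        constructor <;> linarith [hd.1]
    intro x hx y hy hd
    rcases le_total x y with h | h
    · exact aux x hx y hy h hd
    · rw [dist_comm]; rw [dist_comm] at hd; exact aux y hy x hx h hd
  let g : ℝ → X := IccExtend (zero_le_one' ℝ) (domRestrict (Icc (0:ℝ) 1) (fun x => f (p x)))
  have hg : Continuous g := (continuousOn_iff_continuous_domRestrict.1 hgc).Icc_extend'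
  have hgeq : ∀ x ∈ Icc (0:ℝ) 1, g x = f (p x) := fun x hx => by
    simp only [g, IccExtend_of_mem _ _ hx]; rfl
  have g0 : g 0 = f 0 := by rw [hgeq 0 (by simp), hpself 0 h3]
  have g1 : g 1 = f 1 := by rw [hgeq 1 (by simp), hpself 1 h4]
  have hfib : ∀ x y z, 0 ≤ x → x ≤ z → z ≤ y → y ≤ 1 → g x = g y → g z = g x := by
    intro x y z hx hxz hzy hy h
    have mx : x ∈ Icc (0:ℝ) 1 := ⟨hx, by linarith⟩
    have my : y ∈ Icc (0:ℝ) 1 := ⟨by linarith, hy⟩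
    have mz : z ∈ Icc (0:ℝ) 1 := ⟨by linarith, by linarith⟩
    rw [hgeq x mx, hgeq y my] at h
    rw [hgeq x mx, hgeq z mz]
    have o1 := hpmono x mx z mz hxz
    have o2 := hpmono z mz y my hzy
    rcases o1.eq_or_lt with e | l1
    · rw [e]
    rcases o2.eq_or_lt with e | l2
    · rw [e, h]
    exact absurd ⟨l1, l2⟩ (hinj (hpK x mx) (hpK y my) (l1.trans l2) h _ (hpK z mz))
  obtain ⟨γ, a1, a2, a3, a4, a5⟩ := arc_of_interval_fibres hg hfib (by rwa [g0, g1])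
  refine ⟨γ, a1, a2, a3.trans g0, a4.trans g1, fun t ht => ?_⟩
  obtain ⟨s, hs, h⟩ := a5 t ht
  exact ⟨p s, h2 (hpK s hs), by rw [h, hgeq s hs]⟩

theorem arc_of_joinedIn {X : Type*} [MetricSpace X] [CompactSpace X] {U : Set X} {a b : X}
    (h : JoinedIn U a b) (hab : a ≠ b) :
    ∃ γ : ℝ → X, ContinuousOn γ (Icc 0 1) ∧ InjOn γ (Icc 0 1) ∧ γ 0 = a ∧ γ 1 = b ∧
      ∀ t ∈ Icc (0:ℝ) 1, γ t ∈ U := by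
  obtain ⟨P, hP⟩ := h
  obtain ⟨γ, h1, h2, h3, h4, h5⟩ := arc_of_curve P.continuous_extend (by simpa using hab)
  refine ⟨γ, h1, h2, by simpa using h3, by simpa using h4, fun t ht => ?_⟩
  obtain ⟨s, hs, e⟩ := h5 t ht
  rw [e, P.extend_apply hs]
  exact hP _

/-- Two arcs meeting exactly at their endpoints form a simple closed curve. -/
theorem circle_of_two_arcs {X : Type*} [TopologicalSpace X] [T2Space X] {f g : ℝ → X}
    {a b c d : ℝ} (hab : a < b) (hcd : c < d)
    (hf : ContinuousOn f (Icc a b)) (hfi : InjOn f (Icc a b))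
    (hg : ContinuousOn g (Icc c d)) (hgi : InjOn g (Icc c d))
    (hac : f a = g c) (hbd : f b = g d)
    (hdisj : ∀ s ∈ Icc a b, ∀ t ∈ Icc c d, f s = g t → s = a ∨ s = b) :
    ∃ S : Set X, Nonempty (S ≃ₜ Circle) := by
  let p : ℝ := (b - a) + (d - c)
  have hp : 0 < p := by simp only [p]; linarith
  have : Fact (0 < p) := ⟨hp⟩
  let h : ℝ → X := fun t => if t ≤ b then f t else g (d - (t - b))
  have hap : a + p = b + (d - c) := by simp only [p]; ring
  have hcont : ContinuousOn h (Icc a (a + p)) := by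
    have e : Icc a (a + p) = Icc a b ∪ Icc b (a + p) := (Icc_union_Icc_eq_Icc hab.le (by linarith)).symm
    rw [e]
    have h1 : ContinuousOn h (Icc a b) := hf.congr fun t ht => by simp [h, ht.2]
    have h2 : ContinuousOn h (Icc b (a + p)) := by
      have : ContinuousOn (fun t => g (d - (t - b))) (Icc b (a + p)) := by
        refine hg.comp (by fun_prop) fun t ht => ⟨?_, ?_⟩ <;> linarith [ht.1, ht.2]
      refine this.congr fun t ht => ?_
      simp only [h]
      split_ifs with hb
      · have : t = b := le_antisymm hb ht.1
        simp [this, hbd]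
      · rfl
    exact h1.union_of_isClosed h2 isClosed_Icc isClosed_Icc
  have hends : h a = h (a + p) := by
    simp only [h]
    rw [if_pos hab.le, if_neg (by linarith), hac]
    congr 1; linarith
  have hinj : InjOn h (Ico a (a + p)) := by
    have aux : ∀ s ∈ Ico a (a + p), ∀ t ∈ Ico a (a + p), s ≤ b → b < t → h s ≠ h t := by
      intro s hs t ht hsb hbt hst
      simp only [h] at hst
      rw [if_pos hsb, if_neg (by linarith)] at hst
      have ms : s ∈ Icc a b := ⟨hs.1, hsb⟩
      have mt : d - (t - b) ∈ Icc c d := ⟨by linarith [ht.2], by linarith⟩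
      rcases hdisj s ms _ mt hst with rfl | rfl
      · rw [hac] at hst
        have := hgi ⟨le_rfl, hcd.le⟩ mt hst
        linarith [ht.2]
      · rw [hbd] at hst
        have := hgi ⟨hcd.le, le_rfl⟩ mt hst
        linarith
    intro s hs t ht hst
    rcases le_or_gt s b with h1 | h1 <;> rcases le_or_gt t b with h2 | h2
    · simp only [h, if_pos h1, if_pos h2] at hst
      exact hfi ⟨hs.1, h1⟩ ⟨ht.1, h2⟩ hst
    · exact absurd hst (aux s hs t ht h1 h2)
    · exact absurd hst.symm (aux t ht s hs h2 h1)
    · simp only [h, if_neg h1.not_ge, if_neg h2.not_ge] at hst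
      have := hgi ⟨by linarith [hs.2], by linarith⟩ ⟨by linarith [ht.2], by linarith⟩ hst
      linarith
  let F : AddCircle p → X := AddCircle.liftIco p a h
  have hF : Continuous F := AddCircle.liftIco_continuous hends hcont
  have hFi : Function.Injective F := by
    intro x y hxy
    obtain ⟨s, hs, rfl⟩ := AddCircle.coe_image_Ico_eq p a ▸ mem_univ x
    obtain ⟨t, ht, rfl⟩ := AddCircle.coe_image_Ico_eq p a ▸ mem_univ y
    simp only [F] at hxy
    rw [AddCircle.liftIco_coe_apply hs, AddCircle.liftIco_coe_apply ht] at hxy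
    rw [hinj hs ht hxy]
  have hemb := (hF.isClosedEmbedding hFi).isEmbedding
  exact ⟨range F, ⟨hemb.toHomeomorph.symm.trans (AddCircle.homeomorphCircle hp.ne')⟩⟩

/-- In a space without simple closed curves, an arc `F` on `[-1, 1]` is separated by its midpoint. -/
theorem no_bypass {X : Type*} [TopologicalSpace X] [T2Space X]
    (hX : ¬ ∃ S : Set X, Nonempty (S ≃ₜ Circle)) {F g : ℝ → X}
    (hF : ContinuousOn F (Icc (-1) 1)) (hFi : InjOn F (Icc (-1) 1))
    (hg : ContinuousOn g (Icc 0 1)) (hgi : InjOn g (Icc 0 1))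
    (h0 : g 0 = F (-1)) (h1 : g 1 = F 1) (hz : ∀ t ∈ Icc (0:ℝ) 1, g t ≠ F 0) : False := by
  have hB : IsClosed (g '' Icc 0 1) := (isCompact_Icc.image_of_continuousOn hg).isClosed
  have c1 : IsCompact (Icc (-1:ℝ) 0 ∩ F ⁻¹' (g '' Icc 0 1)) :=
    isCompact_Icc.of_isClosed_subset ((hF.mono (Icc_subset_Icc_right zero_le_one)).preimage_isClosed_of_isClosed
      isClosed_Icc hB) inter_subset_left
  have c2 : IsCompact (Icc (0:ℝ) 1 ∩ F ⁻¹' (g '' Icc 0 1)) :=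
    isCompact_Icc.of_isClosed_subset ((hF.mono (Icc_subset_Icc_left (by norm_num))).preimage_isClosed_of_isClosed
      isClosed_Icc hB) inter_subset_left
  obtain ⟨a, ⟨ha, u, hu, hua⟩, hamax⟩ := c1.exists_isGreatest
    ⟨-1, by norm_num, 0, by simp, h0⟩
  obtain ⟨b, ⟨hb, v, hv, hvb⟩, hbmin⟩ := c2.exists_isLeast
    ⟨1, by norm_num, 1, by simp, h1⟩
  have ha0 : a ≠ 0 := by rintro rfl; exact hz u hu hua
  have hb0 : b ≠ 0 := by rintro rfl; exact hz v hv hvb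
  have ha' : a < 0 := lt_of_le_of_ne ha.2 ha0
  have hb' : 0 < b := lt_of_le_of_ne hb.1 hb0.symm
  have hsub : Icc a b ⊆ Icc (-1) 1 := Icc_subset_Icc ha.1 hb.2
  have hFc := hF.mono hsub
  have hFj := hFi.mono hsub
  have hmeet : ∀ s ∈ Icc a b, ∀ t ∈ Icc (0:ℝ) 1, F s = g t → s = a ∨ s = b := by
    intro s hs t ht hst
    rcases le_total s 0 with h | h
    · left
      exact le_antisymm (hamax ⟨⟨ha.1.trans hs.1, h⟩, t, ht, hst.symm⟩) hs.1
    · right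
      exact le_antisymm hs.2 (hbmin ⟨⟨h, hs.2.trans hb.2⟩, t, ht, hst.symm⟩)
  rcases lt_trichotomy u v with h | h | h
  · have hs2 : Icc u v ⊆ Icc 0 1 := Icc_subset_Icc hu.1 hv.2
    exact hX (circle_of_two_arcs (ha'.trans hb') h hFc hFj (hg.mono hs2) (hgi.mono hs2)
      hua.symm hvb.symm fun s hs t ht => hmeet s hs t (hs2 ht))
  · subst h
    have := hFj ⟨le_rfl, (ha'.trans hb').le⟩ ⟨(ha'.trans hb').le, le_rfl⟩ (hua.symm.trans hvb)
    linarith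
  · have hs2 : Icc v u ⊆ Icc 0 1 := Icc_subset_Icc hv.1 hu.2
    have hneg : MapsTo (fun t : ℝ => -t) (Icc (-b) (-a)) (Icc a b) :=
      fun t ht => ⟨by linarith [ht.2], by linarith [ht.1]⟩
    refine hX (circle_of_two_arcs (f := fun t => F (-t)) (a := -b) (b := -a) (by linarith) h
      (hFc.comp (by fun_prop) hneg) (hFj.comp neg_injective.injOn hneg) (hg.mono hs2)
      (hgi.mono hs2) (by simpa using hvb.symm) (by simpa using hua.symm) ?_)
    intro s hs t ht hst
    rcases hmeet _ (hneg hs) t (hs2 ht) hst with h | h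
    · right; linarith
    · left; linarith

/-- Two arcs issuing from `z` and otherwise disjoint end in different components of `X \ {z}`. -/
theorem separated {X : Type*} [MetricSpace X] [CompactSpace X] [LocallyPathConnectedSpace X]
    (hX : ¬ ∃ S : Set X, Nonempty (S ≃ₜ Circle)) {f k : ℝ → X} {z : X}
    (hf : ContinuousOn f (Icc 0 1)) (hfi : InjOn f (Icc 0 1))
    (hk : ContinuousOn k (Icc 0 1)) (hki : InjOn k (Icc 0 1))
    (hf0 : f 0 = z) (hk0 : k 0 = z)
    (hd : ∀ s ∈ Icc (0:ℝ) 1, ∀ t ∈ Icc (0:ℝ) 1, f s = k t → s = 0 ∧ t = 0) :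
    connectedComponentIn ({z}ᶜ : Set X) (f 1) ≠ connectedComponentIn ({z}ᶜ : Set X) (k 1) := by
  intro heq
  have hf1 : f 1 ∈ ({z}ᶜ : Set X) := fun h =>
    one_ne_zero (hfi (by simp) (by simp) ((mem_singleton_iff.1 h).trans hf0.symm))
  have hk1 : k 1 ∈ ({z}ᶜ : Set X) := fun h =>
    one_ne_zero (hki (by simp) (by simp) ((mem_singleton_iff.1 h).trans hk0.symm))
  have hne : f 1 ≠ k 1 := fun h => one_ne_zero (hd 1 (by simp) 1 (by simp) h).1
  have hopen : IsOpen (connectedComponentIn ({z}ᶜ : Set X) (f 1)) :=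
    isOpen_compl_singleton.connectedComponentIn
  have hpc : IsPathConnected (connectedComponentIn ({z}ᶜ : Set X) (f 1)) :=
    hopen.isConnected_iff_isPathConnected.1 (isConnected_connectedComponentIn_iff.2 hf1)
  have hj : JoinedIn ({z}ᶜ : Set X) (f 1) (k 1) :=
    (hpc.joinedIn _ (mem_connectedComponentIn hf1) _
      (heq ▸ mem_connectedComponentIn hk1)).mono (connectedComponentIn_subset _ _)
  obtain ⟨g, g1, g2, g3, g4, g5⟩ := arc_of_joinedIn hj hne
  let F : ℝ → X := fun t => if t ≤ 0 then f (-t) else k t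
  have e1 : F 0 = z := by simp [F, hf0]
  have e2 : F (-1) = f 1 := by simp [F]
  have e3 : F 1 = k 1 := by simp [F]
  refine no_bypass hX (F := F) ?_ ?_ g1 g2 (by rw [g3, e2]) (by rw [g4, e3])
    (fun t ht => by rw [e1]; exact g5 t ht)
  · have e : Icc (-1:ℝ) 1 = Icc (-1) 0 ∪ Icc 0 1 :=
      (Icc_union_Icc_eq_Icc (by norm_num) (by norm_num)).symm
    rw [e]
    refine ContinuousOn.union_of_isClosed ?_ ?_ isClosed_Icc isClosed_Icc
    · have : ContinuousOn (fun t => f (-t)) (Icc (-1) 0) :=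
        hf.comp (by fun_prop) fun t ht => ⟨by linarith [ht.2], by linarith [ht.1]⟩
      exact this.congr fun t ht => by simp [F, ht.2]
    · refine hk.congr fun t ht => ?_
      simp only [F]
      split_ifs with h
      · have : t = 0 := le_antisymm h ht.1
        simp [this, hf0, hk0]
      · rfl
  · intro s hs t ht hst
    simp only [F] at hst
    split_ifs at hst with h1 h2 h2
    · have := hfi ⟨by linarith, by linarith [hs.1]⟩ ⟨by linarith, by linarith [ht.1]⟩ hst
      linarith
    · have := hd _ ⟨by linarith, by linarith [hs.1]⟩ _ ⟨by linarith, ht.2⟩ hst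
      linarith [this.1, this.2]
    · have := hd _ ⟨by linarith, by linarith [ht.1]⟩ _ ⟨by linarith, hs.2⟩ hst.symm
      linarith [this.1, this.2]
    · exact hki ⟨by linarith, hs.2⟩ ⟨by linarith, ht.2⟩ hst

/-- In a nondegenerate dendrite without free arcs, the branch points are dense. -/
theorem branchPoints_dense_of_no_freeArc (X : Type*) [TopologicalSpace X]
    [Nontrivial X] (hX : IsDendrite X) (hfree : ¬ HasFreeArc X) :
    Dense {x : X | IsBranchPoint X x} := by
  obtain ⟨-, hcomp, hconn, hmet, hlc, hcirc⟩ := hX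
  letI : MetricSpace X := TopologicalSpace.metrizableSpaceMetric X
  have hlpc : LocallyPathConnectedSpace X := locallyPathConnected_of_compact X
  by_contra hdense
  rw [dense_iff_inter_open] at hdense
  push Not at hdense
  obtain ⟨U, hU, ⟨x₀, hx₀⟩, hUb⟩ := hdense
  have hnb : ∀ x ∈ U, ¬ IsBranchPoint X x := fun x hx hb =>
    (eq_empty_iff_forall_notMem.1 hUb) x ⟨hx, hb⟩
  -- a nondegenerate arc inside `U`
  have hCo : IsOpen (connectedComponentIn U x₀) := hU.connectedComponentIn
  have hCp : IsPathConnected (connectedComponentIn U x₀) :=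
    hCo.isConnected_iff_isPathConnected.1 (isConnected_connectedComponentIn_iff.2 hx₀)
  obtain ⟨y₀, hy₀, hne₀⟩ : ∃ y ∈ connectedComponentIn U x₀, y ≠ x₀ := by
    have h1 : ∀ᶠ y in 𝓝[≠] x₀, y ∈ connectedComponentIn U x₀ :=
      mem_nhdsWithin_of_mem_nhds (hCo.mem_nhds (mem_connectedComponentIn hx₀))
    have h2 : ∀ᶠ y in 𝓝[≠] x₀, y ≠ x₀ := self_mem_nhdsWithin
    exact (h1.and h2).exists
  obtain ⟨f, f1, f2, f3, f4, f5⟩ := arc_of_joinedIn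
    ((hCp.joinedIn _ (mem_connectedComponentIn hx₀) _ hy₀).mono (connectedComponentIn_subset _ _))
    hne₀.symm
  refine hfree ⟨f, f1, f2, ?_⟩
  rw [isOpen_iff_mem_nhds]
  rintro _ ⟨τ, hτ, rfl⟩
  have hτ' : τ ∈ Icc (0:ℝ) 1 := Ioo_subset_Icc_self hτ
  -- a connected neighbourhood missing the endpoints
  let W : Set X := U ∩ ({f 0}ᶜ ∩ {f 1}ᶜ)
  have hW : IsOpen W := hU.inter (isOpen_compl_singleton.inter isOpen_compl_singleton)
  have hxW : f τ ∈ W := by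
    refine ⟨f5 τ hτ', fun h => ?_, fun h => ?_⟩
    · exact hτ.1.ne' (f2 hτ' (by simp) h)
    · exact hτ.2.ne (f2 hτ' (by simp) h)
  have hVo : IsOpen (connectedComponentIn W (f τ)) := hW.connectedComponentIn
  have hVp : IsPathConnected (connectedComponentIn W (f τ)) :=
    hVo.isConnected_iff_isPathConnected.1 (isConnected_connectedComponentIn_iff.2 hxW)
  have hxV := mem_connectedComponentIn hxW
  refine mem_of_superset (hVo.mem_nhds hxV) fun y hy => ?_
  have hyW := connectedComponentIn_subset _ _ hy
  suffices hyA : y ∈ f '' Icc 0 1 by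
    obtain ⟨t, ht, rfl⟩ := hyA
    refine ⟨t, ⟨lt_of_le_of_ne ht.1 ?_, lt_of_le_of_ne ht.2 ?_⟩, rfl⟩
    · rintro rfl; exact hyW.2.1 rfl
    · rintro rfl; exact hyW.2.2 rfl
  by_contra hyA
  have hne : y ≠ f τ := by rintro rfl; exact hyA ⟨τ, hτ', rfl⟩
  obtain ⟨q, q1, q2, q3, q4, q5⟩ := arc_of_joinedIn
    ((hVp.joinedIn _ hy _ hxV).mono (connectedComponentIn_subset _ _)) hne
  have hA : IsClosed (f '' Icc 0 1) := (isCompact_Icc.image_of_continuousOn f1).isClosed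
  have hc : IsCompact (Icc (0:ℝ) 1 ∩ q ⁻¹' (f '' Icc 0 1)) :=
    isCompact_Icc.of_isClosed_subset (q1.preimage_isClosed_of_isClosed isClosed_Icc hA)
      inter_subset_left
  obtain ⟨r, ⟨hr, c, hc, hcr⟩, hrmin⟩ := hc.exists_isLeast ⟨1, by simp, τ, hτ', q4.symm⟩
  have hr0 : 0 < r := by
    refine lt_of_le_of_ne hr.1 ?_
    rintro rfl
    exact hyA ⟨c, hc, by rw [hcr, q3]⟩
  have hzW : f c ∈ W := hcr ▸ q5 r hr
  have hc0 : 0 < c := lt_of_le_of_ne hc.1 (by rintro rfl; exact hzW.2.1 rfl)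
  have hc1 : c < 1 := lt_of_le_of_ne hc.2 (by rintro rfl; exact hzW.2.2 rfl)
  -- three arcs from the point `f c`
  have affine : ∀ u v : ℝ, u ∈ Icc (0:ℝ) 1 → v ∈ Icc (0:ℝ) 1 →
      MapsTo (fun t : ℝ => u + t * (v - u)) (Icc 0 1) (Icc 0 1) := by
    intro u v hu hv t ht
    have e : u + t * (v - u) = (1 - t) * u + t * v := by ring
    have h1 : 0 ≤ 1 - t := by linarith [ht.2]
    constructor
    · simp only [e]
      have := mul_nonneg h1 hu.1
      have := mul_nonneg ht.1 hv.1
      linarith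
    · simp only [e]
      have := mul_le_mul_of_nonneg_left hu.2 h1
      have := mul_le_mul_of_nonneg_left hv.2 ht.1
      linarith
  have affinj : ∀ u v : ℝ, u ≠ v → InjOn (fun t : ℝ => u + t * (v - u)) (Icc 0 1) := by
    intro u v huv s _ t _ h
    simp only [add_right_inj] at h
    exact mul_right_cancel₀ (sub_ne_zero.2 huv.symm) h
  have m0 : (0:ℝ) ∈ Icc (0:ℝ) 1 := by simp
  have m1 : (1:ℝ) ∈ Icc (0:ℝ) 1 := by simp
  let k₁ : ℝ → X := fun t => f (c + t * (0 - c))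
  let k₂ : ℝ → X := fun t => f (c + t * (1 - c))
  let k₃ : ℝ → X := fun t => q (r + t * (0 - r))
  have a1 : ContinuousOn k₁ (Icc 0 1) := f1.comp (by fun_prop) (affine c 0 hc m0)
  have a2 : ContinuousOn k₂ (Icc 0 1) := f1.comp (by fun_prop) (affine c 1 hc m1)
  have a3 : ContinuousOn k₃ (Icc 0 1) := q1.comp (by fun_prop) (affine r 0 hr m0)
  have b1 : InjOn k₁ (Icc 0 1) := f2.comp (affinj c 0 hc0.ne') (affine c 0 hc m0)
  have b2 : InjOn k₂ (Icc 0 1) := f2.comp (affinj c 1 hc1.ne) (affine c 1 hc m1)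
  have b3 : InjOn k₃ (Icc 0 1) := q2.comp (affinj r 0 hr0.ne') (affine r 0 hr m0)
  have z1 : k₁ 0 = f c := by simp [k₁]
  have z2 : k₂ 0 = f c := by simp [k₂]
  have z3 : k₃ 0 = f c := by simp [k₃, hcr]
  have d12 : ∀ s ∈ Icc (0:ℝ) 1, ∀ t ∈ Icc (0:ℝ) 1, k₁ s = k₂ t → s = 0 ∧ t = 0 := by
    intro s hs t ht hst
    have := f2 (affine c 0 hc m0 hs) (affine c 1 hc m1 ht) hst
    simp only at this
    have p1 : 0 ≤ s * c := mul_nonneg hs.1 hc0.le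
    have p2 : 0 ≤ t * (1 - c) := mul_nonneg ht.1 (by linarith)
    have e1 : s * c = 0 := by linarith
    have e2 : t * (1 - c) = 0 := by linarith
    exact ⟨(mul_eq_zero.1 e1).resolve_right hc0.ne',
      (mul_eq_zero.1 e2).resolve_right (by linarith)⟩
  have dA : ∀ w ∈ Icc (0:ℝ) 1, ∀ t ∈ Icc (0:ℝ) 1, f w = k₃ t → t = 0 ∧ w = c := by
    intro w hw t ht hst
    have := hrmin ⟨affine r 0 hr m0 ht, w, hw, hst⟩
    have p1 : 0 ≤ t * r := mul_nonneg ht.1 hr0.le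
    have e1 : t * r = 0 := by linarith
    have ht0 := (mul_eq_zero.1 e1).resolve_right hr0.ne'
    refine ⟨ht0, f2 hw hc ?_⟩
    rw [hst, ht0, z3]
  have d13 : ∀ s ∈ Icc (0:ℝ) 1, ∀ t ∈ Icc (0:ℝ) 1, k₁ s = k₃ t → s = 0 ∧ t = 0 := by
    intro s hs t ht hst
    obtain ⟨e1, e2⟩ := dA _ (affine c 0 hc m0 hs) t ht hst
    have e3 : s * c = 0 := by linarith
    exact ⟨(mul_eq_zero.1 e3).resolve_right hc0.ne', e1⟩
  have d23 : ∀ s ∈ Icc (0:ℝ) 1, ∀ t ∈ Icc (0:ℝ) 1, k₂ s = k₃ t → s = 0 ∧ t = 0 := by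
    intro s hs t ht hst
    obtain ⟨e1, e2⟩ := dA _ (affine c 1 hc m1 hs) t ht hst
    have e3 : s * (1 - c) = 0 := by linarith
    exact ⟨(mul_eq_zero.1 e3).resolve_right (by linarith), e1⟩
  refine hnb (f c) hzW.1 ⟨k₁ 1, k₂ 1, k₃ 1, ?_, ?_, ?_,
    separated hcirc a1 b1 a2 b2 z1 z2 d12, separated hcirc a1 b1 a3 b3 z1 z3 d13,
    separated hcirc a2 b2 a3 b3 z2 z3 d23⟩
  · intro h; exact one_ne_zero (b1 m1 m0 (h.trans z1.symm))
  · intro h; exact one_ne_zero (b2 m1 m0 (h.trans z2.symm))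
  · intro h; exact one_ne_zero (b3 m1 m0 (h.trans z3.symm))
end

section
/- Let g be a homeomorphism of a dendrite X. Then either the fixed-point set Fix(g) is connected (hence a sub-dendrite), or there exists an austro-boreal arc for g, i.e., an arc [x,y] with x ≠ y such that Fix(g) ∩ [x,y] = {x,y}. -/
open Set

theorem dd_chain {X : Type*} [PseudoMetricSpace X] {C : Set X} (hC : IsPreconnected C) {δ : ℝ}
    (hδ : 0 < δ) {u v : X} (hu : u ∈ C) (hv : v ∈ C) :
    ∃ (N : ℕ) (c : ℕ → X), c 0 = u ∧ (∀ k, N ≤ k → c k = v) ∧ (∀ k, c k ∈ C) ∧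
      ∀ k, dist (c k) (c (k+1)) < δ := by
  have key : Relation.ReflTransGen (fun a b => a ∈ C ∧ b ∈ C ∧ dist a b < δ) u v := by
    refine hC.induction₂ (fun a b => Relation.ReflTransGen (fun a b => a ∈ C ∧ b ∈ C ∧ dist a b < δ) a b)
      ?_ ?_ ?_ hu hv
    · intro x hx
      filter_upwards [inter_mem_nhdsWithin C (Metric.ball_mem_nhds x hδ)] with y hy
      exact Relation.ReflTransGen.single ⟨hx, hy.1, by simpa [dist_comm] using hy.2⟩
    · intro x y z _ _ _ h1 h2
      exact h1.trans h2
    · intro x y _ _ h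
      refine Relation.ReflTransGen.head_induction_on h Relation.ReflTransGen.refl ?_
      rintro a c ⟨h1, h2, h3⟩ _ ih
      exact ih.tail ⟨h2, h1, by rwa [dist_comm]⟩
  induction key using Relation.ReflTransGen.head_induction_on with
  | refl => exact ⟨0, fun _ => v, rfl, fun _ _ => rfl, fun _ => hv, fun _ => by simpa using hδ⟩
  | @head a b h _ ih =>
    obtain ⟨N, c, h0, h1, h2, h3⟩ := ih h.2.1
    refine ⟨N+1, fun k => Nat.casesOn k a c, rfl, ?_, ?_, ?_⟩
    · rintro (_ | k) hk
      · omega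
      · exact h1 k (by omega)
    · rintro (_ | k)
      · exact h.1
      · exact h2 k
    · rintro (_ | k)
      · simpa [h0] using h.2.2
      · exact h3 k

theorem dd_ulc {X : Type*} [PseudoMetricSpace X] [CompactSpace X] [LocallyConnectedSpace X]
    {ε : ℝ} (hε : 0 < ε) : ∃ δ > 0, ∀ x y : X, dist x y < δ →
      ∃ C : Set X, IsPreconnected C ∧ x ∈ C ∧ y ∈ C ∧ ∀ z ∈ C, dist z x < ε := by
  have h := fun x : X => locallyConnectedSpace_iff_subsets_isOpen_isConnected.1 ‹_› x
    (Metric.ball x (ε/2)) (Metric.ball_mem_nhds x (by positivity))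
  choose V hVb hVo hxV hVc using h
  obtain ⟨δ, hδ, H⟩ := lebesgue_number_lemma_of_metric (s := univ) isCompact_univ hVo
    (fun x _ => mem_iUnion.2 ⟨x, hxV x⟩)
  refine ⟨δ, hδ, fun x y hxy => ?_⟩
  obtain ⟨i, hi⟩ := H x (mem_univ x)
  have hx : x ∈ V i := hi (Metric.mem_ball_self hδ)
  refine ⟨V i, (hVc i).isPreconnected, hx,
    hi (by simpa [dist_comm] using hxy), fun z hz => ?_⟩
  have h1 : dist z i < ε/2 := hVb i hz
  have h2 : dist x i < ε/2 := hVb i hx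
  have := dist_triangle_right z x i
  linarith

/-- refinement step -/
theorem dd_step {X : Type*} [PseudoMetricSpace X] {δ δ' ε : ℝ} (hδ' : 0 < δ') (hε : 0 < ε)
    (H : ∀ x y : X, dist x y < δ →
      ∃ C : Set X, IsPreconnected C ∧ x ∈ C ∧ y ∈ C ∧ ∀ z ∈ C, dist z x < ε)
    {M : ℕ} {p : ℕ → X} {y : X} (hM : ∀ k, M ≤ k → p k = y)
    (hp : ∀ k, dist (p k) (p (k+1)) < δ) :
    ∃ (N : ℕ) (q : ℕ → X), 0 < N ∧ q 0 = p 0 ∧ (∀ k, M * N ≤ k → q k = y) ∧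
      (∀ k, dist (q k) (q (k+1)) < δ') ∧ ∀ k, dist (q k) (p (k / N)) < ε := by
  have h : ∀ i, ∃ (N : ℕ) (c : ℕ → X), c 0 = p i ∧ (∀ k, N ≤ k → c k = p (i+1)) ∧
      (∀ k, dist (c k) (p i) < ε) ∧ (∀ k, dist (c k) (c (k+1)) < δ') := by
    intro i
    obtain ⟨C, hC, h1, h2, h3⟩ := H _ _ (hp i)
    obtain ⟨N, c, a1, a2, a3, a4⟩ := dd_chain hC hδ' h1 h2
    exact ⟨N, c, a1, a2, fun k => h3 _ (a3 k), a4⟩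
  choose L c h0 h1 h2 h3 using h
  let N := (Finset.range M).sup L + 1
  let d : ℕ → ℕ → X := fun i => if i < M then c i else fun _ => y
  have d0 : ∀ i, d i 0 = p i := by
    intro i
    by_cases hi : i < M
    · simp [d, hi, h0]
    · simp [d, hi, hM i (by omega)]
  have d1 : ∀ i, d i N = p (i+1) := by
    intro i
    by_cases hi : i < M
    · have : L i ≤ (Finset.range M).sup L := Finset.le_sup (by simpa using hi)
      simp only [d, hi, if_true]
      exact h1 i N (by omega)
    · simp [d, hi, hM (i+1) (by omega)]
  have d2 : ∀ i k, dist (d i k) (p i) < ε := by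
    intro i k
    by_cases hi : i < M
    · simp [d, hi, h2]
    · simp [d, hi, hM i (by omega), hε]
  have d3 : ∀ i k, dist (d i k) (d i (k+1)) < δ' := by
    intro i k
    by_cases hi : i < M
    · simp [d, hi, h3]
    · simp [d, hi, hδ']
  have hN : 0 < N := by omega
  refine ⟨N, fun k => d (k / N) (k % N), hN, by simp [d0], ?_, ?_, fun k => d2 _ _⟩
  · intro k hk
    have : ¬ (k / N < M) := by
      rw [not_lt, Nat.le_div_iff_mul_le hN]; exact hk
    simp [d, this]
  · intro k
    have hk := d3 (k / N) (k % N)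
    have e := Nat.div_add_mod k N
    have lt := Nat.mod_lt k hN
    by_cases hc : k % N + 1 < N
    · have e1 : (k+1) / N = k / N := by
        rw [Nat.div_eq_iff hN, mul_comm]; omega
      have e2 : (k+1) % N = k % N + 1 := by
        have := Nat.div_add_mod (k+1) N
        rw [e1] at this; omega
      simpa [e1, e2] using hk
    · have e0 : k % N + 1 = N := by omega
      have e1 : k + 1 = N * (k / N + 1) := by rw [mul_add]; omega
      have e2 : (k+1) / N = k / N + 1 := by rw [e1, Nat.mul_div_cancel_left _ hN]
      have e3 : (k+1) % N = 0 := by rw [e1]; simp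
      simp only [e2, e3, d0]
      rwa [e0, d1] at hk

theorem dd_path {X : Type*} [MetricSpace X] [CompactSpace X] [LocallyConnectedSpace X]
    [ConnectedSpace X] (x y : X) : ∃ f : ℝ → X, ContinuousOn f (Icc 0 1) ∧ f 0 = x ∧ f 1 = y := by
  have hU := fun n : ℕ => dd_ulc (X := X) (ε := (1/2)^n) (by positivity)
  choose δ0 hδ0 H0 using hU
  let δ : ℕ → ℝ := fun n => min (δ0 n) ((1/2)^n)
  have hδ : ∀ n, 0 < δ n := fun n => lt_min (hδ0 n) (by positivity)
  let G : ℕ → ℕ × (ℕ → X) → Prop := fun n s => 0 < s.1 ∧ s.2 0 = x ∧ (∀ k, s.1 ≤ k → s.2 k = y) ∧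
    ∀ k, dist (s.2 k) (s.2 (k+1)) < δ n
  have hs : ∀ n (s : {s // G n s}), ∃ s' : {s // G (n+1) s}, ∃ N, 0 < N ∧ s'.1.1 = s.1.1 * N ∧
      ∀ k, dist (s'.1.2 k) (s.1.2 (k / N)) < (1/2)^n := by
    rintro n ⟨⟨M, p⟩, g1, g2, g3, g4⟩
    obtain ⟨N, q, hN, a1, a2, a3, a4⟩ := dd_step (hδ (n+1)) (ε := (1/2)^n) (by positivity)
      (H0 n) (p := p) (M := M) (y := y) g3 (fun k => (g4 k).trans_le (min_le_left _ _))
    exact ⟨⟨⟨M * N, q⟩, Nat.mul_pos g1 hN, a1.trans g2, a2, a3⟩, N, hN, rfl, a4⟩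
  have hi : ∃ s, G 0 s := by
    obtain ⟨N, c, a1, a2, -, a4⟩ := dd_chain (isPreconnected_univ (α := X)) (hδ 0)
      (mem_univ x) (mem_univ y)
    exact ⟨⟨N+1, c⟩, by simp, a1, fun k hk => a2 k (by simp at hk; omega), a4⟩
  obtain ⟨s0, hs0⟩ := hi
  choose nx Nn hN hM hd using hs
  let S : ∀ n, {s // G n s} := fun n => Nat.rec ⟨s0, hs0⟩ (fun n s => nx n s) n
  have hS : ∀ n, S (n+1) = nx n (S n) := fun n => rfl
  let g : ℕ → ℝ → X := fun n t => (S n).1.2 ⌊t * (S n).1.1⌋₊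
  have gd : ∀ t n, dist (g n t) (g (n+1) t) ≤ 1 * (1/2)^n := by
    intro t n
    rw [dist_comm, one_mul]
    have := hd n (S n) ⌊t * (S (n+1)).1.1⌋₊
    rw [← hS] at this
    have e : ⌊t * (S n).1.1⌋₊ = ⌊t * (S (n+1)).1.1⌋₊ / Nn n (S n) := ?_
    · rw [← e] at this; exact this.le
    rw [hS, hM, ← Nat.floor_div_natCast]
    have : ((Nn n (S n) : ℕ) : ℝ) ≠ 0 := by
      have := hN n (S n); positivity
    congr 1
    push_cast
    field_simp
  have hc : ∀ t, ∃ l, Filter.Tendsto (fun n => g n t) Filter.atTop (nhds l) := fun t =>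
    cauchySeq_tendsto_of_complete (cauchySeq_of_le_geometric (1/2) 1 (by norm_num) (gd t))
  choose f hf using hc
  have hfd : ∀ t n, dist (g n t) (f t) ≤ 2 * (1/2)^n := by
    intro t n
    have := dist_le_of_le_geometric_of_tendsto (1/2) 1 (by norm_num) (gd t) (hf t) n
    refine this.trans (le_of_eq (by ring))
  refine ⟨f, ?_, ?_, ?_⟩
  · rw [Metric.continuousOn_iff]
    intro t ht ε hε
    obtain ⟨n, hn⟩ := exists_pow_lt_of_lt_one (show (0:ℝ) < ε/5 by positivity) (show (1/2:ℝ) < 1 by norm_num)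
    obtain ⟨g1, g2, g3, g4⟩ := (S n).2
    have hMp : (0:ℝ) < (S n).1.1 := by exact_mod_cast g1
    refine ⟨1 / (S n).1.1, by positivity, ?_⟩
    have main : ∀ a b : ℝ, 0 ≤ a → a ≤ b → b < a + 1 / (S n).1.1 → dist (g n a) (g n b) < (1/2)^n := by
      intro a b ha hab hb
      have h1 : ⌊a * (S n).1.1⌋₊ ≤ ⌊b * (S n).1.1⌋₊ := Nat.floor_le_floor (by gcongr)
      have h2 : ⌊b * (S n).1.1⌋₊ ≤ ⌊a * (S n).1.1⌋₊ + 1 := by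
        rw [← Nat.floor_add_one (by positivity)]
        apply Nat.floor_le_floor
        have : b * (S n).1.1 ≤ (a + 1 / (S n).1.1) * (S n).1.1 := by gcongr
        refine this.trans (le_of_eq (by field_simp))
      rcases Nat.le_succ_iff.1 h2 with h | h
      · have := le_antisymm h1 h
        simp only [g, this, dist_self]; positivity
      · simp only [g]; rw [h]
        exact (g4 _).trans_le (min_le_right _ _)
    intro b hb hbt
    have h3 : dist (g n b) (g n t) < (1/2)^n := by
      rw [Real.dist_eq, abs_lt] at hbt
      rcases le_total b t with h | h
      · exact main b t hb.1 h (by linarith)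
      · rw [dist_comm]; exact main t b ht.1 h (by linarith)
    have h1 := hfd b n
    have h2 := hfd t n
    have := dist_triangle4 (f b) (g n b) (g n t) (f t)
    rw [dist_comm (f b) (g n b)] at this
    linarith
  · refine tendsto_nhds_unique (hf 0) ?_
    have : ∀ n, g n 0 = x := fun n => by simp [g, (S n).2.2.1]
    simp [this]
  · refine tendsto_nhds_unique (hf 1) ?_
    have : ∀ n, g n 1 = y := fun n => by simp [g, (S n).2.2.2.1]
    simp [this]

/-- Closed subsets of the interval whose gaps are closed up by the path. -/
def DDGood {X : Type*} (γ : ℝ → X) (K : Set ℝ) : Prop :=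
  IsClosed K ∧ K ⊆ Icc 0 1 ∧ (0:ℝ) ∈ K ∧ (1:ℝ) ∈ K ∧
    ∀ a ∈ K, ∀ b ∈ K, a < b → Disjoint (Ioo a b) K → γ a = γ b

/-- largest point of K below t -/
theorem dd_left {K : Set ℝ} (hK : IsClosed K) {t : ℝ} {z : ℝ} (hz : z ∈ K) (hzt : z ≤ t) :
    ∃ a ∈ K, a ≤ t ∧ ∀ k ∈ K, k ≤ t → k ≤ a := by
  have hb : BddAbove (K ∩ Iic t) := ⟨t, fun _ h => h.2⟩
  have h := (hK.inter isClosed_Iic).csSup_mem ⟨z, hz, hzt⟩ hb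
  exact ⟨_, h.1, h.2, fun k hk hkt => le_csSup hb ⟨hk, hkt⟩⟩

theorem dd_right {K : Set ℝ} (hK : IsClosed K) {t : ℝ} {z : ℝ} (hz : z ∈ K) (hzt : t ≤ z) :
    ∃ a ∈ K, t ≤ a ∧ ∀ k ∈ K, t ≤ k → a ≤ k := by
  have hb : BddBelow (K ∩ Ici t) := ⟨t, fun _ h => h.2⟩
  have h := (hK.inter isClosed_Ici).csInf_mem ⟨z, hz, hzt⟩ hb
  exact ⟨_, h.1, h.2, fun k hk hkt => csInf_le hb ⟨hk, hkt⟩⟩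

theorem dd_min {X : Type*} [MetricSpace X] {γ : ℝ → X} (hγ : Continuous γ) :
    ∃ K, Minimal (DDGood γ) K := by
  have h01 : DDGood γ (Icc 0 1) := by
    refine ⟨isClosed_Icc, Subset.rfl, by simp, by simp, ?_⟩
    intro a ha b hb hab hd
    exact absurd hd (Set.not_disjoint_iff.2 ⟨(a+b)/2, ⟨by linarith, by linarith⟩,
      by linarith [ha.1, hb.1], by linarith [ha.2, hb.2]⟩)
  suffices h : ∃ m ⊆ Icc (0:ℝ) 1, Minimal (fun K => K ∈ {K | DDGood γ K}) m by
    obtain ⟨m, -, hm⟩ := h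
    exact ⟨m, hm⟩
  refine zorn_superset_nonempty {K | DDGood γ K} ?_ _ h01
  intro c hcS hc hne
  refine ⟨⋂₀ c, ⟨isClosed_sInter fun K hK => (hcS hK).1, ?_, ?_, ?_, ?_⟩,
    fun s hs => sInter_subset_of_mem hs⟩
  · obtain ⟨K, hK⟩ := hne
    exact (sInter_subset_of_mem hK).trans (hcS hK).2.1
  · exact fun K hK => (hcS hK).2.2.1
  · exact fun K hK => (hcS hK).2.2.2.1
  intro a ha b hb hab hd
  by_contra hne'
  have hpos : 0 < dist (γ a) (γ b) := dist_pos.2 hne'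
  obtain ⟨ε1, hε1, h1⟩ := Metric.continuous_iff.1 hγ a _ (half_pos hpos)
  obtain ⟨ε2, hε2, h2⟩ := Metric.continuous_iff.1 hγ b _ (half_pos hpos)
  obtain ⟨ε, hε, l1, l2, l3⟩ : ∃ ε > 0, ε < ε1 ∧ ε < ε2 ∧ ε < (b - a) / 2 := by
    refine ⟨min (min ε1 ε2) ((b-a)/2) / 2, ?_, ?_, ?_, ?_⟩
    · have : 0 < b - a := by linarith
      positivity
    all_goals
      have : 0 < min (min ε1 ε2) ((b-a)/2) := lt_min (lt_min hε1 hε2) (by linarith)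
      have := min_le_left (min ε1 ε2) ((b-a)/2)
      have := min_le_right (min ε1 ε2) ((b-a)/2)
      have := min_le_left ε1 ε2
      have := min_le_right ε1 ε2
      linarith
  obtain ⟨K, hK, hKd⟩ : ∃ K ∈ c, Disjoint (Icc (a+ε) (b-ε)) K := by
    have hemp : Icc (a+ε) (b-ε) ∩ ⋂ K : c, (K : Set ℝ) = ∅ := by
      rw [← sInter_eq_iInter, Set.eq_empty_iff_forall_notMem]
      rintro z ⟨hz1, hz2⟩
      exact Set.disjoint_left.1 hd ⟨by linarith [hz1.1], by linarith [hz1.2]⟩ hz2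
    have hnon : Nonempty c := hne.to_subtype
    obtain ⟨K, hK⟩ := isCompact_Icc.elim_directed_family_closed (fun K : c => (K : Set ℝ))
      (fun K => (hcS K.2).1) hemp (by
        intro A B
        rcases hc.total A.2 B.2 with h | h
        · exact ⟨A, Subset.rfl, h⟩
        · exact ⟨B, h, Subset.rfl⟩)
    exact ⟨K, K.2, Set.disjoint_iff_inter_eq_empty.2 hK⟩
  obtain ⟨gc, -, -, -, gg⟩ := hcS hK
  obtain ⟨a', ha', ha1, ha2⟩ := dd_left gc (ha K hK) (show a ≤ a + ε by linarith)
  obtain ⟨b', hb', hb1, hb2⟩ := dd_right gc (hb K hK) (show b - ε ≤ b by linarith)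
  have haa := ha2 a (ha K hK) (by linarith)
  have hbb := hb2 b (hb K hK) (by linarith)
  have := gg a' ha' b' hb' (by linarith) (by
    rw [Set.disjoint_left]
    rintro z ⟨hz1, hz2⟩ hz
    rcases le_or_gt z (a+ε) with h | h
    · linarith [ha2 z hz h]
    rcases le_or_gt (b-ε) z with h' | h'
    · linarith [hb2 z hz h']
    exact Set.disjoint_left.1 hKd ⟨h.le, h'.le⟩ hz)
  have e1 := h1 a' (by rw [Real.dist_eq, abs_lt]; constructor <;> linarith)
  have e2 := h2 b' (by rw [Real.dist_eq, abs_lt]; constructor <;> linarith)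
  rw [this] at e1
  have := dist_triangle_left (γ a) (γ b) (γ b')
  linarith

theorem dd_mono {X : Type*} [MetricSpace X] {γ : ℝ → X} (hγ : Continuous γ) :
    ∃ h : ℝ → X, ContinuousOn h (Icc 0 1) ∧ h 0 = γ 0 ∧ h 1 = γ 1 ∧
      ∀ s ∈ Icc (0:ℝ) 1, ∀ t ∈ Icc (0:ℝ) 1, ∀ r, s ≤ r → r ≤ t → h s = h t → h r = h s := by
  obtain ⟨K, hK⟩ := dd_min hγ
  obtain ⟨kc, ks, k0, k1, kg⟩ := hK.prop
  have hmin : ∀ s ∈ K, ∀ t ∈ K, s < t → γ s = γ t → Disjoint (Ioo s t) K := by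
    intro s hs t ht hst he
    have hgood : DDGood γ (K \ Ioo s t) := by
      refine ⟨kc.sdiff isOpen_Ioo, sdiff_subset.trans ks, ⟨k0, fun h => ?_⟩, ⟨k1, fun h => ?_⟩, ?_⟩
      · linarith [h.1, (ks hs).1]
      · linarith [h.2, (ks ht).2]
      rintro a ⟨ha, ha'⟩ b ⟨hb, hb'⟩ hab hd
      rw [Set.disjoint_left] at hd
      have hsd : s ∈ K \ Ioo s t := ⟨hs, fun h => lt_irrefl _ h.1⟩
      have htd : t ∈ K \ Ioo s t := ⟨ht, fun h => lt_irrefl _ h.2⟩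
      have A : a ≤ s ∨ t ≤ a := by
        by_contra! h; exact ha' h
      have B : b ≤ s ∨ t ≤ b := by
        by_contra! h; exact hb' h
      rcases A with A | A
      · rcases B with B | B
        · refine kg a ha b hb hab (Set.disjoint_left.2 fun z hz hzK => hd hz ⟨hzK, fun h => ?_⟩)
          linarith [hz.2, h.1]
        · have e1 : a = s := by
            by_contra hne
            exact hd ⟨lt_of_le_of_ne A hne, by linarith⟩ hsd
          have e2 : b = t := by
            by_contra hne
            exact hd ⟨by linarith, lt_of_le_of_ne B (Ne.symm hne)⟩ htd
          rw [e1, e2, he]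
      · refine kg a ha b hb hab (Set.disjoint_left.2 fun z hz hzK => hd hz ⟨hzK, fun h => ?_⟩)
        linarith [hz.1, h.2]
    have := hK.le_of_le hgood sdiff_subset
    rw [Set.disjoint_left]
    exact fun z hz hzK => (this hzK).2 hz
  have hL : ∀ t, ∃ a, t ∈ Icc (0:ℝ) 1 → a ∈ K ∧ a ≤ t ∧ ∀ k ∈ K, k ≤ t → k ≤ a := by
    intro t
    by_cases ht : t ∈ Icc (0:ℝ) 1
    · obtain ⟨a, h1, h2, h3⟩ := dd_left kc k0 ht.1
      exact ⟨a, fun _ => ⟨h1, h2, h3⟩⟩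
    · exact ⟨0, fun h => absurd h ht⟩
  have hR : ∀ t, ∃ a, t ∈ Icc (0:ℝ) 1 → a ∈ K ∧ t ≤ a ∧ ∀ k ∈ K, t ≤ k → a ≤ k := by
    intro t
    by_cases ht : t ∈ Icc (0:ℝ) 1
    · obtain ⟨a, h1, h2, h3⟩ := dd_right kc k1 ht.2
      exact ⟨a, fun _ => ⟨h1, h2, h3⟩⟩
    · exact ⟨0, fun h => absurd h ht⟩
  choose ρ hρ using hL
  choose σ hσ using hR
  have hρσ : ∀ t ∈ Icc (0:ℝ) 1, γ (ρ t) = γ (σ t) := by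
    intro t ht
    obtain ⟨a1, a2, a3⟩ := hρ t ht
    obtain ⟨b1, b2, b3⟩ := hσ t ht
    rcases (a2.trans b2).eq_or_lt with h | h
    · rw [h]
    · refine kg _ a1 _ b1 h (Set.disjoint_left.2 fun z hz hzK => ?_)
      rcases le_total z t with h' | h'
      · linarith [a3 z hzK h', hz.1]
      · linarith [b3 z hzK h', hz.2]
  have hρK : ∀ t ∈ K, ρ t = t := fun t ht =>
    le_antisymm (hρ t (ks ht)).2.1 ((hρ t (ks ht)).2.2 t ht le_rfl)
  refine ⟨fun t => γ (ρ t), ?_, by simp only [hρK 0 k0], by simp only [hρK 1 k1], ?_⟩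
  · intro t ht
    by_cases htK : t ∈ K
    · rw [Metric.continuousWithinAt_iff]
      intro ε hε
      obtain ⟨δ, hδ, H⟩ := Metric.continuous_iff.1 hγ t ε hε
      refine ⟨δ, hδ, fun {s} hs hst => ?_⟩
      rw [hρK t htK]
      rw [Real.dist_eq, abs_lt] at hst
      rcases le_total s t with h | h
      · rw [hρσ s hs]
        have h1 := (hσ s hs).2.1
        have h2 := (hσ s hs).2.2 t htK h
        exact H _ (by rw [Real.dist_eq, abs_lt]; constructor <;> linarith)
      · have h1 := (hρ s hs).2.1
        have h2 := (hρ s hs).2.2 t htK h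
        exact H _ (by rw [Real.dist_eq, abs_lt]; constructor <;> linarith)
    · obtain ⟨a1, a2, a3⟩ := hρ t ht
      obtain ⟨b1, b2, b3⟩ := hσ t ht
      have a2' : ρ t < t := lt_of_le_of_ne a2 fun h => htK (h ▸ a1)
      have b2' : t < σ t := lt_of_le_of_ne b2 fun h => htK (h.symm ▸ b1)
      have : (fun s => γ (ρ s)) =ᶠ[nhdsWithin t (Icc 0 1)] fun _ => γ (ρ t) := by
        filter_upwards [inter_mem_nhdsWithin (Icc 0 1) (Ioo_mem_nhds a2' b2')] with s hs
        obtain ⟨c1, c2, c3⟩ := hρ s hs.1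
        congr 1
        refine le_antisymm (a3 _ c1 ?_) (c3 _ a1 hs.2.1.le)
        by_contra! h
        linarith [b3 _ c1 h.le, hs.2.2]
      exact continuousWithinAt_const.congr_of_eventuallyEq this rfl
  · intro s hs t ht r hsr hrt he
    have hr : r ∈ Icc (0:ℝ) 1 := ⟨hs.1.trans hsr, hrt.trans ht.2⟩
    obtain ⟨a1, a2, a3⟩ := hρ s hs
    obtain ⟨b1, b2, b3⟩ := hρ r hr
    obtain ⟨c1, c2, c3⟩ := hρ t ht
    have l1 := b3 _ a1 (a2.trans hsr)
    have l2 := c3 _ b1 (b2.trans hrt)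
    simp only at he ⊢
    rcases l1.eq_or_lt with h | h
    · rw [h]
    rcases l2.eq_or_lt with h' | h'
    · rw [h', he]
    exact absurd b1 (Set.disjoint_left.1 (hmin _ a1 _ c1 (h.trans h') he) ⟨h, h'⟩)

theorem dd_clamp {X : Type*} [TopologicalSpace X] {f : ℝ → X} (hf : ContinuousOn f (Icc 0 1)) :
    ∃ h : ℝ → X, Continuous h ∧ ∀ t ∈ Icc (0:ℝ) 1, h t = f t := by
  refine ⟨IccExtend zero_le_one (fun t => f t), ?_, fun t ht => IccExtend_of_mem _ _ ht⟩
  exact (continuousOn_iff_continuous_domRestrict.1 hf).Icc_extend'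

theorem dd_arc {X : Type*} [MetricSpace X] [CompactSpace X] {γ : ℝ → X} (hγ : Continuous γ)
    (hne : γ 0 ≠ γ 1) :
    ∃ f : ℝ → X, ContinuousOn f (Icc 0 1) ∧ InjOn f (Icc 0 1) ∧ f 0 = γ 0 ∧ f 1 = γ 1 := by
  obtain ⟨h', hc', h0', h1', hm'⟩ := dd_mono hγ
  obtain ⟨h, hc, hh⟩ := dd_clamp hc'
  have h0 : h 0 = γ 0 := by rw [hh 0 (by simp), h0']
  have h1 : h 1 = γ 1 := by rw [hh 1 (by simp), h1']
  have hm : ∀ s ∈ Icc (0:ℝ) 1, ∀ t ∈ Icc (0:ℝ) 1, ∀ r, s ≤ r → r ≤ t → h s = h t → h r = h s := by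
    intro s hs t ht r hsr hrt
    rw [hh s hs, hh t ht, hh r ⟨hs.1.trans hsr, hrt.trans ht.2⟩]
    exact hm' s hs t ht r hsr hrt
  clear hm' hh h0' h1' hc' h'
  have hXn : Nonempty X := ⟨γ 0⟩
  let x := TopologicalSpace.denseSeq X
  let D := Metric.diam (univ : Set X)
  have hD : ∀ a b : X, dist a b ≤ D := fun a b =>
    Metric.dist_le_diam_of_mem isCompact_univ.isBounded (mem_univ a) (mem_univ b)
  let φ : ℕ → ℝ → ℝ → ℝ := fun n t s => - dist (h (min s t)) (x n)
  have hφ : ∀ n, Continuous ↿(φ n) := by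
    intro n
    simp only [φ, Function.HasUncurry.uncurry]
    fun_prop
  let M : ℕ → ℝ → ℝ := fun n t => sSup (φ n t '' Icc 0 1)
  have hMc : ∀ n, Continuous (M n) := fun n => isCompact_Icc.continuous_sSup (hφ n)
  have hφ' : ∀ n t, Continuous (φ n t) := fun n t => by
    simp only [φ]; fun_prop
  have hMex : ∀ n t, ∃ s ∈ Icc (0:ℝ) 1, M n t = φ n t s := fun n t =>
    isCompact_Icc.exists_sSup_image_eq (nonempty_Icc.2 zero_le_one) (hφ' n t).continuousOn
  have hMle : ∀ n t, ∀ s ∈ Icc (0:ℝ) 1, φ n t s ≤ M n t := fun n t s hs =>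
    le_csSup (isCompact_Icc.image (hφ' n t)).bddAbove (mem_image_of_mem _ hs)
  have hMb : ∀ n t, ‖(1/2)^n * M n t‖ ≤ (1/2)^n * D := by
    intro n t
    obtain ⟨s, -, hs⟩ := hMex n t
    rw [norm_mul, hs]
    have : ‖((1/2:ℝ))^n‖ = (1/2)^n := by simp
    rw [this]
    have : ‖φ n t s‖ ≤ D := by simpa [φ] using hD (h (min s t)) (x n)
    gcongr
  have hsum : Summable fun n : ℕ => (1/2:ℝ)^n * D := summable_geometric_two.mul_right D
  have hsm : ∀ t, Summable fun n => (1/2)^n * M n t := fun t =>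
    Summable.of_norm_bounded hsum (hMb · t)
  let w : ℝ → ℝ := fun t => ∑' n, (1/2)^n * M n t
  have hw : Continuous w := continuous_tsum (fun n => (hMc n).const_mul _) hsum hMb
  have hMmono : ∀ n, ∀ s ∈ Icc (0:ℝ) 1, ∀ t ∈ Icc (0:ℝ) 1, s ≤ t → M n s ≤ M n t := by
    intro n s hs t ht hst
    obtain ⟨r, hr, e⟩ := hMex n s
    rw [e]
    have := hMle n t (min r s) ⟨le_min hr.1 hs.1, (min_le_left _ _).trans hr.2⟩
    simp only [φ] at this ⊢
    rwa [min_eq_left ((min_le_right r s).trans hst)] at this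
  have hwm : ∀ s ∈ Icc (0:ℝ) 1, ∀ t ∈ Icc (0:ℝ) 1, s ≤ t → w s ≤ w t := by
    intro s hs t ht hst
    refine (hsm s).tsum_le_tsum (fun n => ?_) (hsm t)
    have := hMmono n s hs t ht hst
    gcongr
  have hws : ∀ s ∈ Icc (0:ℝ) 1, ∀ t ∈ Icc (0:ℝ) 1, s ≤ t → h s ≠ h t → w s < w t := by
    intro s hs t ht hst hne
    have hnot : h t ∉ h '' Icc 0 s := by
      rintro ⟨r, hr, e⟩
      have := hm r ⟨hr.1, hr.2.trans hs.2⟩ t ht s hr.2 hst e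
      exact hne (this.trans e)
    have hcl : IsClosed (h '' Icc 0 s) := (isCompact_Icc.image hc).isClosed
    obtain ⟨η, hη, hb⟩ := Metric.isOpen_iff.1 hcl.isOpen_compl _ hnot
    obtain ⟨n, hn⟩ := (TopologicalSpace.denseRange_denseSeq X).exists_dist_lt (h t) (half_pos hη)
    refine Summable.tsum_lt_tsum (i := n) (fun n => ?_) ?_ (hsm s) (hsm t)
    · have := hMmono n s hs t ht hst
      gcongr
    have : M n s < M n t := by
      obtain ⟨r, hr, e⟩ := hMex n s
      have h2 := hMle n t t ht
      rw [e]
      refine lt_of_lt_of_le ?_ h2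
      simp only [φ, min_self, neg_lt_neg_iff]
      have h3 : ¬ dist (h (min r s)) (h t) < η := fun hlt =>
        hb hlt (mem_image_of_mem _ ⟨le_min hr.1 hs.1, min_le_right _ _⟩)
      have h4 := dist_triangle_right (h (min r s)) (h t) (x n)
      change dist (h t) (x n) < η / 2 at hn
      linarith
    gcongr
  have I0 : (0:ℝ) ∈ Icc (0:ℝ) 1 := by simp
  have I1 : (1:ℝ) ∈ Icc (0:ℝ) 1 := by simp
  have hlt : w 0 < w 1 := hws 0 I0 1 I1 zero_le_one (by rwa [h0, h1])
  have hinj : ∀ s ∈ Icc (0:ℝ) 1, ∀ t ∈ Icc (0:ℝ) 1, w s = w t → h s = h t := by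
    intro s hs t ht e
    by_contra hne
    rcases le_total s t with hst | hst
    · exact (hws s hs t ht hst hne).ne e
    · exact (hws t ht s hs hst (Ne.symm hne)).ne e.symm
  have hinj2 : ∀ s ∈ Icc (0:ℝ) 1, ∀ t ∈ Icc (0:ℝ) 1, h s = h t → w s = w t := by
    have key : ∀ s ∈ Icc (0:ℝ) 1, ∀ t ∈ Icc (0:ℝ) 1, s ≤ t → h s = h t → w t ≤ w s := by
      intro s hs t ht hst e
      refine (hsm t).tsum_le_tsum (fun n => ?_) (hsm s)
      have : M n t ≤ M n s := by
        obtain ⟨r, hr, e'⟩ := hMex n t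
        rw [e']
        have hrt : min r t ∈ Icc (0:ℝ) 1 := ⟨le_min hr.1 ht.1, (min_le_left _ _).trans hr.2⟩
        rcases le_total (min r t) s with hh | hh
        · have := hMle n s _ hrt
          simp only [φ] at this ⊢
          rwa [min_eq_left hh] at this
        · have e2 := hm s hs t ht _ hh (min_le_right _ _) e
          have := hMle n s s hs
          simp only [φ] at this ⊢
          rw [e2]
          rwa [min_self] at this
      gcongr
    intro s hs t ht e
    rcases le_total s t with hst | hst
    · exact le_antisymm (hwm s hs t ht hst) (key s hs t ht hst e)
    · exact le_antisymm (key t ht s hs hst e.symm) (hwm t ht s hs hst)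
  have hsurj : ∀ v, ∃ t, v ∈ Icc (0:ℝ) 1 → t ∈ Icc (0:ℝ) 1 ∧ w t = w 0 + (w 1 - w 0) * v := by
    intro v
    by_cases hv : v ∈ Icc (0:ℝ) 1
    · have := intermediate_value_Icc (zero_le_one (α := ℝ)) hw.continuousOn
      obtain ⟨t, ht, e⟩ := this (show w 0 + (w 1 - w 0) * v ∈ Icc (w 0) (w 1) from
        ⟨by nlinarith [hv.1], by nlinarith [hv.2]⟩)
      exact ⟨t, fun _ => ⟨ht, e⟩⟩
    · exact ⟨0, fun h => absurd h hv⟩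
  choose τ hτ using hsurj
  refine ⟨fun v => h (τ v), ?_, ?_, ?_, ?_⟩
  · rw [continuousOn_iff_isClosed]
    intro C hC
    refine ⟨(fun v => w 0 + (w 1 - w 0) * v) ⁻¹' (w '' (Icc 0 1 ∩ h ⁻¹' C)), ?_, ?_⟩
    · refine IsClosed.preimage (by fun_prop) ?_
      exact ((isCompact_Icc.inter_right (hC.preimage hc)).image hw).isClosed
    · ext v
      constructor
      · rintro ⟨a, b⟩
        exact ⟨⟨τ v, ⟨(hτ v b).1, a⟩, (hτ v b).2⟩, b⟩
      · rintro ⟨⟨t, ⟨ht, htC⟩, e⟩, b⟩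
        refine ⟨?_, b⟩
        have := hinj _ (hτ v b).1 t ht ((hτ v b).2.trans e.symm)
        change h (τ v) ∈ C
        rw [this]; exact htC
  · intro v hv v' hv' e
    have := hinj2 _ (hτ v hv).1 _ (hτ v' hv').1 e
    rw [(hτ v hv).2, (hτ v' hv').2] at this
    have h3 : (w 1 - w 0) * v = (w 1 - w 0) * v' := by linarith
    exact mul_left_cancel₀ (by linarith) h3
  · change h (τ 0) = _
    rw [← h0]
    exact hinj _ (hτ 0 I0).1 _ I0 (by rw [(hτ 0 I0).2]; ring)
  · change h (τ 1) = _
    rw [← h1]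
    exact hinj _ (hτ 1 I1).1 _ I1 (by rw [(hτ 1 I1).2]; ring)

theorem dd_final {X : Type*} [MetricSpace X] {F : Set X} (hF : IsClosed F)
    (harc : ∀ x y : X, x ≠ y → ∃ f : ℝ → X, ContinuousOn f (Icc 0 1) ∧ InjOn f (Icc 0 1) ∧
      f 0 = x ∧ f 1 = y) : IsPreconnected F ∨
      ∃ f : ℝ → X, ContinuousOn f (Icc 0 1) ∧ InjOn f (Icc 0 1) ∧ f 0 ≠ f 1 ∧
        F ∩ (f '' Icc 0 1) = {f 0, f 1} := by
  by_contra! hcon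
  obtain ⟨hnp, hno⟩ := hcon
  apply hnp
  refine isPreconnected_of_forall_pair fun x hx y hy => ?_
  by_cases hxy : x = y
  · subst hxy
    exact ⟨{x}, by simpa using hx, rfl, rfl, isPreconnected_singleton⟩
  obtain ⟨f, fc, fi, f0, f1⟩ := harc x y hxy
  refine ⟨f '' Icc 0 1, ?_, ⟨0, by simp, f0⟩, ⟨1, by simp, f1⟩, isPreconnected_Icc.image _ fc⟩
  rintro _ ⟨t, ht, rfl⟩
  by_contra htF
  have hP : IsClosed (Icc 0 1 ∩ f ⁻¹' F) := fc.preimage_isClosed_of_isClosed isClosed_Icc hF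
  obtain ⟨a, ⟨haI, haF⟩, hat, ha⟩ := dd_left hP (t := t) (z := 0)
    ⟨by simp, by simpa [f0] using hx⟩ ht.1
  obtain ⟨b, ⟨hbI, hbF⟩, hbt, hb⟩ := dd_right hP (t := t) (z := 1)
    ⟨by simp, by simpa [f1] using hy⟩ ht.2
  have hab : a < b := by
    refine lt_of_le_of_ne (hat.trans hbt) fun h => htF ?_
    have : t = a := le_antisymm (h ▸ hbt) hat
    rw [this]; exact haF
  have hmaps : ∀ s ∈ Icc (0:ℝ) 1, a + (b - a) * s ∈ Icc a b := fun s hs =>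
    ⟨by nlinarith [hs.1], by nlinarith [hs.2]⟩
  have hsub : Icc a b ⊆ Icc 0 1 := Icc_subset_Icc haI.1 hbI.2
  have hinj : InjOn (fun s => f (a + (b - a) * s)) (Icc 0 1) := by
    intro s hs s' hs' e
    have := fi (hsub (hmaps s hs)) (hsub (hmaps s' hs')) e
    have h3 : (b - a) * s = (b - a) * s' := by linarith
    exact mul_left_cancel₀ (by linarith) h3
  refine hno (fun s => f (a + (b - a) * s)) ?_ hinj ?_ ?_
  · exact fc.comp (by fun_prop) fun s hs => hsub (hmaps s hs)
  · intro e
    exact zero_ne_one (hinj (by simp) (by simp) e)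
  · have e0 : a + (b - a) * 0 = a := by ring
    have e1 : a + (b - a) * 1 = b := by ring
    simp only [e0, e1]
    ext z
    simp only [mem_inter_iff, mem_image, mem_insert_iff, mem_singleton_iff]
    constructor
    · rintro ⟨hz, s, hs, rfl⟩
      have hm := hmaps s hs
      rcases le_total (a + (b - a) * s) t with h | h
      · left
        rw [le_antisymm (ha _ ⟨hsub hm, hz⟩ h) hm.1]
      · right
        rw [le_antisymm hm.2 (hb _ ⟨hsub hm, hz⟩ h)]
    · rintro (rfl | rfl)
      · exact ⟨haF, 0, by simp, by rw [e0]⟩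
      · exact ⟨hbF, 1, by simp, by rw [e1]⟩

/-- For a homeomorphism `g` of a dendrite, either the fixed-point set is connected
(hence a sub-dendrite), or there is an austro-boreal arc for `g`: an arc meeting
`Fix(g)` exactly in its two distinct endpoints. -/
theorem fix_connected_or_austroBoreal (X : Type*) [TopologicalSpace X]
    (hX : IsDendrite X) (g : X ≃ₜ X) :
    IsPreconnected {x : X | g x = x} ∨
      ∃ f : ℝ → X, ContinuousOn f (Icc 0 1) ∧ InjOn f (Icc 0 1) ∧ f 0 ≠ f 1 ∧
        {x : X | g x = x} ∩ (f '' Icc 0 1) = {f 0, f 1} := by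
  obtain ⟨-, hcp, hcn, hmz, hlc, -⟩ := hX
  letI : MetricSpace X := TopologicalSpace.metrizableSpaceMetric X
  refine dd_final (isClosed_eq g.continuous continuous_id) fun x y hxy => ?_
  obtain ⟨p, pc, p0, p1⟩ := dd_path x y
  obtain ⟨q, qc, hq⟩ := dd_clamp pc
  have q0 : q 0 = x := by rw [hq 0 (by simp), p0]
  have q1 : q 1 = y := by rw [hq 1 (by simp), p1]
  obtain ⟨f, h1, h2, h3, h4⟩ := dd_arc qc (by rwa [q0, q1])
  exact ⟨f, h1, h2, h3.trans q0, h4.trans q1⟩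
end
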